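/- There is an absolute constant c such that for sets X, Y, Z ⊆ F_p^* with sizes X, Y, Z and M = max(X,Y,Z), the number N(X,Y,Z) of solutions of x₁(y₁ − z₁) = x₂(y₂ − z₂) with x₁,x₂ ∈ X, y₁,y₂ ∈ Y, z₁,z₂ ∈ Z satisfies N(X,Y,Z) ≤ c·(X²Y²Z²/p + X^{3/2}Y^{3/2}Z^{3/2} + M·XYZ). -/

import Mathlib

namespace Rud
open MvPolynomial

/-- Elimination of the first variable. -/
lemma elim_exists {K : Type*} [Field K] (F G : MvPolynomial (Fin 3) K) (hF : Irreducible F)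
    (hFG : ¬ F ∣ G) (d e : ℕ) (hd : F.totalDegree ≤ d) (he : G.totalDegree ≤ e) :
    ∃ r : MvPolynomial (Fin 2) K, r ≠ 0 ∧ r.totalDegree ≤ (d + e + 1) * max d e ∧
      ∃ P Q : Polynomial (MvPolynomial (Fin 2) K),
        finSuccEquiv K 2 F * P + finSuccEquiv K 2 G * Q = Polynomial.C r := by
  classical
  have hco : ∀ (H : MvPolynomial (Fin 3) K) (i : ℕ),
      ((finSuccEquiv K 2 H).coeff i).totalDegree ≤ H.totalDegree := by
    intro H i
    by_cases h : (finSuccEquiv K 2 H).coeff i = 0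
    · simp [h]
    · have := totalDegree_coeff_finSuccEquiv_add_le H i h
      omega
  have hnd : ∀ (H : MvPolynomial (Fin 3) K), (finSuccEquiv K 2 H).natDegree ≤ H.totalDegree := by
    intro H
    rw [natDegree_finSuccEquiv]
    exact degreeOf_le_totalDegree H 0
  set f := finSuccEquiv K 2 F with hf
  set g := finSuccEquiv K 2 G with hg
  have hfirr : Irreducible f := (MulEquiv.irreducible_iff (finSuccEquiv K 2)).2 hF
  have hfg : ¬ f ∣ g := fun h => hFG ((map_dvd_iff (finSuccEquiv K 2)).1 h)
  by_cases hdeg : f.natDegree = 0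
  · obtain ⟨r, hr⟩ := Polynomial.natDegree_eq_zero.1 hdeg
    refine ⟨r, ?_, ?_, 1, 0, by simp [hr]⟩
    · rintro rfl
      exact hfirr.ne_zero (by simp [← hr])
    · have : r = f.coeff 0 := by simp [← hr]
      rw [this]
      have h1 := hco F 0
      have h2 : d ≤ max d e := le_max_left _ _
      nlinarith
  · refine ⟨f.resultant g, ?_, ?_, ?_⟩
    · intro h0
      let Q := FractionRing (MvPolynomial (Fin 2) K)
      have hinj : Function.Injective (algebraMap (MvPolynomial (Fin 2) K) Q) :=
        IsFractionRing.injective _ _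
      have hprim : f.IsPrimitive := hfirr.isPrimitive hdeg
      have h1 : (f.map (algebraMap _ Q)).resultant (g.map (algebraMap _ Q)) = 0 := by
        rw [Polynomial.natDegree_map_eq_of_injective hinj, Polynomial.natDegree_map_eq_of_injective hinj,
          Polynomial.resultant_map_map, h0, map_zero]
      rw [Polynomial.resultant_eq_zero_iff] at h1
      have hirr : Irreducible (f.map (algebraMap _ Q)) :=
        (hprim.irreducible_iff_irreducible_map_fraction_map).1 hfirr
      have hdvd : f.map (algebraMap _ Q) ∣ g.map (algebraMap _ Q) := by
        by_contra hnd
        exact h1.2 ((hirr.coprime_iff_not_dvd).2 hnd)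
      obtain ⟨q, hq⟩ := hdvd
      obtain ⟨c, hc, hcq⟩ := IsLocalization.integerNormalization_spec (nonZeroDivisors (MvPolynomial (Fin 2) K)) q
      have hc0 : c ≠ 0 := nonZeroDivisors.ne_zero hc
      set q' := IsLocalization.integerNormalization (nonZeroDivisors (MvPolynomial (Fin 2) K)) q
      have h2 : f ∣ Polynomial.C c * g := by
        refine ⟨q', Polynomial.map_injective _ hinj ?_⟩
        rw [Polynomial.map_mul, Polynomial.map_mul, hq, hcq]
        simp only [Polynomial.map_C]
        rw [Algebra.smul_def]
        simp [Polynomial.algebraMap_apply]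
        ring
      rcases hfirr.prime.dvd_or_dvd h2 with h3 | h3
      · apply hdeg
        have := Polynomial.natDegree_le_of_dvd h3 (by simpa using hc0)
        simpa using this
      · exact hfg h3
    · have hent : ∀ i j, (Polynomial.sylvester f g f.natDegree g.natDegree i j).totalDegree ≤ max d e := by
        intro i j
        unfold Polynomial.sylvester
        simp only [Matrix.of_apply]
        induction j using Fin.addCases with
        | left j =>
          simp only [Fin.addCases_left]
          split_ifs
          · exact ((hco G _).trans he).trans (le_max_right _ _)
          · simp
        | right j =>
          simp only [Fin.addCases_right]
          split_ifs
          · exact ((hco F _).trans hd).trans (le_max_left _ _)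
          · simp
      unfold Polynomial.resultant
      rw [Matrix.det_apply]
      refine totalDegree_finsetSum_le fun σ _ => ?_
      refine (totalDegree_smul_le _ _).trans ?_
      refine (totalDegree_finsetProd _ _).trans ?_
      refine (Finset.sum_le_sum fun i _ => hent _ _).trans ?_
      simp only [Finset.sum_const, Finset.card_univ, Fintype.card_fin, smul_eq_mul]
      have h1 : f.natDegree ≤ _ := hnd F
      have h2 : g.natDegree ≤ _ := hnd G
      apply Nat.mul_le_mul_right
      omega
    · obtain ⟨P, Q, -, -, h⟩ := Polynomial.exists_mul_add_mul_eq_C_resultant f g le_rfl le_rfl (Or.inl hdeg)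
      exact ⟨P, Q, h⟩

/-- the restriction to the line `v = η - ξ u, w = ζ`; variables: `0 = v`, `1 = w`, `2 = u`. -/
noncomputable def lineA {K : Type*} [Field K] (ξ η ζ : K) :
    MvPolynomial (Fin 3) K →ₐ[K] Polynomial K :=
  aeval ![Polynomial.C η - Polynomial.C ξ * Polynomial.X, Polynomial.C ζ, Polynomial.X]

noncomputable def lineB {K : Type*} [Field K] (ξ η ζ : K) :
    MvPolynomial (Fin 3) K →ₐ[K] Polynomial K :=
  aeval ![Polynomial.C ζ, Polynomial.C η - Polynomial.C ξ * Polynomial.X, Polynomial.X]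

lemma lineA_natDegree {K : Type*} [Field K] (ξ η ζ : K) (F : MvPolynomial (Fin 3) K) :
    (lineA ξ η ζ F).natDegree ≤ F.totalDegree := by
  have := MvPolynomial.aeval_natDegree_le F (m := F.totalDegree) le_rfl
    (![Polynomial.C η - Polynomial.C ξ * Polynomial.X, Polynomial.C ζ, Polynomial.X] : Fin 3 → Polynomial K)
    (n := 1) (by
      intro i
      fin_cases i
      · simp; compute_degree
      · simp
      · simp)
  simpa [lineA] using this

lemma lineB_natDegree {K : Type*} [Field K] (ξ η ζ : K) (F : MvPolynomial (Fin 3) K) :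
    (lineB ξ η ζ F).natDegree ≤ F.totalDegree := by
  have := MvPolynomial.aeval_natDegree_le F (m := F.totalDegree) le_rfl
    (![Polynomial.C ζ, Polynomial.C η - Polynomial.C ξ * Polynomial.X, Polynomial.X] : Fin 3 → Polynomial K)
    (n := 1) (by
      intro i
      fin_cases i
      · simp
      · simp; compute_degree
      · simp)
  simpa [lineB] using this

lemma elim_count {K ι : Type*} [Field K] (F G : MvPolynomial (Fin 3) K) (hF : Irreducible F)
    (hFG : ¬ F ∣ G) (d e : ℕ) (hd : F.totalDegree ≤ d) (he : G.totalDegree ≤ e)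
    (ξ η ζ : ι → K) (S : Finset ι) (hζ : Function.Injective ζ)
    (hSF : ∀ a ∈ S, lineA (ξ a) (η a) (ζ a) F = 0)
    (hSG : ∀ a ∈ S, lineA (ξ a) (η a) (ζ a) G = 0) :
    S.card ≤ (d + e + 1) * max d e := by
  classical
  obtain ⟨r, hr0, hrd, P, Q, hPQ⟩ := elim_exists F G hF hFG d e hd he
  refine le_trans ?_ hrd
  have key : ∀ a ∈ S, aeval ![Polynomial.C (ζ a), (Polynomial.X : Polynomial K)] r = 0 := by
    intro a ha
    let φ : MvPolynomial (Fin 2) K →ₐ[K] Polynomial K :=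
      aeval ![Polynomial.C (ζ a), (Polynomial.X : Polynomial K)]
    let y : Polynomial K := Polynomial.C (η a) - Polynomial.C (ξ a) * Polynomial.X
    have hev : ∀ H : MvPolynomial (Fin 3) K,
        Polynomial.eval₂ (φ : MvPolynomial (Fin 2) K →+* Polynomial K) y (finSuccEquiv K 2 H)
          = lineA (ξ a) (η a) (ζ a) H := by
      intro H
      have : ((Polynomial.eval₂RingHom (φ : MvPolynomial (Fin 2) K →+* Polynomial K) y).comp
        (finSuccEquiv K 2 : MvPolynomial (Fin 3) K →+* _)) =
          (lineA (ξ a) (η a) (ζ a) : MvPolynomial (Fin 3) K →+* Polynomial K) := by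
        apply MvPolynomial.ringHom_ext
        · intro c
          simp [finSuccEquiv_apply, φ, lineA]
        · intro i
          fin_cases i
          · simp [finSuccEquiv_apply, lineA, y]
          · simp [finSuccEquiv_apply, lineA, φ]
            rw [show (1 : Fin 3) = Fin.succ 0 from rfl, Fin.cases_succ]
            simp
          · simp [finSuccEquiv_apply, lineA, φ]
            rw [show (2 : Fin 3) = Fin.succ 1 from rfl, Fin.cases_succ]
            simp
      exact congrArg (fun h => h H) this
    have := congrArg (Polynomial.eval₂ (φ : MvPolynomial (Fin 2) K →+* Polynomial K) y) hPQ
    rw [Polynomial.eval₂_add, Polynomial.eval₂_mul, Polynomial.eval₂_mul, hev, hev, hSF a ha, hSG a ha,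
      Polynomial.eval₂_C] at this
    simpa using this.symm
  let R := finSuccEquiv K 1 r
  have hR0 : R ≠ 0 := by simpa [R] using hr0
  have hroots : ∀ a ∈ S, R.IsRoot (C (ζ a)) := by
    intro a ha
    have hk := key a ha
    have hinj : Function.Injective (aeval ![(Polynomial.X : Polynomial K)] : MvPolynomial (Fin 1) K →ₐ[K] Polynomial K) := by
      have : (aeval ![(Polynomial.X : Polynomial K)] : MvPolynomial (Fin 1) K →ₐ[K] Polynomial K) =
        (MvPolynomial.uniqueAlgEquiv K (Fin 1) : MvPolynomial (Fin 1) K →ₐ[K] Polynomial K) := by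
        apply MvPolynomial.algHom_ext
        intro i
        fin_cases i
        simp
      rw [this]
      exact (MvPolynomial.uniqueAlgEquiv K (Fin 1)).injective
    apply hinj
    rw [map_zero, ← hk]
    have : (((aeval ![(Polynomial.X : Polynomial K)] : MvPolynomial (Fin 1) K →ₐ[K] Polynomial K) : MvPolynomial (Fin 1) K →+* Polynomial K).comp
      ((Polynomial.evalRingHom (C (ζ a) : MvPolynomial (Fin 1) K)).comp (finSuccEquiv K 1 : MvPolynomial (Fin 2) K →+* _))) =
       ((aeval ![Polynomial.C (ζ a), (Polynomial.X : Polynomial K)] : MvPolynomial (Fin 2) K →ₐ[K] Polynomial K) : _ →+* _) := by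
      apply MvPolynomial.ringHom_ext
      · intro c
        simp [finSuccEquiv_apply]
      · intro i
        fin_cases i
        · simp [finSuccEquiv_apply]
        · simp [finSuccEquiv_apply]
          rw [show (1 : Fin 2) = Fin.succ 0 from rfl, Fin.cases_succ]
          simp
    exact congrArg (fun h => h r) this
  calc S.card = (S.image fun a => (C (ζ a) : MvPolynomial (Fin 1) K)).card := by
        rw [Finset.card_image_of_injective]
        exact (C_injective _ _).comp hζ
    _ ≤ R.roots.toFinset.card := by
        apply Finset.card_le_card
        intro x hx
        obtain ⟨a, ha, rfl⟩ := Finset.mem_image.1 hx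
        simp only [Multiset.mem_toFinset]
        exact (Polynomial.mem_roots hR0).2 (hroots a ha)
    _ ≤ R.roots.card := Multiset.toFinset_card_le _
    _ ≤ R.natDegree := Polynomial.card_roots' _
    _ ≤ r.totalDegree := by
        rw [natDegree_finSuccEquiv]
        exact degreeOf_le_totalDegree r 0
end Rud


namespace Rud
open MvPolynomial

lemma poly_const_zero {E : Type*} [Field E] (p : ℕ) [Fact p.Prime] [CharP E p]
    (σ : E →+* DualNumber E) (u : E) (hu : σ u = TrivSqZeroExt.inl u + DualNumber.eps)
    (n : ℕ) : ∀ Ψ : Polynomial E, Ψ.natDegree ≤ n → n < p →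
      (∀ i, σ (Ψ.coeff i) = TrivSqZeroExt.inl (Ψ.coeff i)) → Ψ.eval u = 0 → Ψ = 0 := by
  induction n with
  | zero =>
    intro Ψ hd _ _ hu
    rw [Polynomial.eq_C_of_natDegree_le_zero hd] at hu ⊢
    simpa using hu
  | succ n ih =>
    intro Ψ hd hn hc h0
    have hder : Ψ.derivative = 0 := by
      apply ih
      · exact (Polynomial.natDegree_derivative_le Ψ).trans (by omega)
      · omega
      · intro i
        rw [Polynomial.coeff_derivative, map_mul, hc, map_add, map_natCast, map_one]
        rw [TrivSqZeroExt.inl_mul, TrivSqZeroExt.inl_add, TrivSqZeroExt.inl_natCast, TrivSqZeroExt.inl_one]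
      · have h1 : σ (Ψ.eval u) = 0 := by rw [h0, map_zero]
        rw [Polynomial.eval_eq_sum_range, map_sum] at h1
        have h2 : Polynomial.aeval (algebraMap E (DualNumber E) u + DualNumber.eps) Ψ = 0 := by
          rw [← h1, Polynomial.aeval_eq_sum_range]
          apply Finset.sum_congr rfl
          intro i _
          rw [map_mul, map_pow, hc, hu, Algebra.smul_def]
          rfl
        rw [Polynomial.aeval_add_of_sq_eq_zero _ _ _ (by rw [pow_two]; exact DualNumber.eps_mul_eps)] at h2
        rw [Polynomial.aeval_algebraMap_apply_eq_algebraMap_eval,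
          Polynomial.aeval_algebraMap_apply_eq_algebraMap_eval] at h2
        have h3 := congrArg TrivSqZeroExt.snd h2
        simpa [TrivSqZeroExt.algebraMap_eq_inl] using h3
    have hconst : Ψ.natDegree = 0 := by
      by_contra hne
      have h1 : Ψ.derivative.coeff (Ψ.natDegree - 1) = 0 := by rw [hder]; simp
      rw [Polynomial.coeff_derivative] at h1
      have h2 : Ψ.natDegree - 1 + 1 = Ψ.natDegree := by omega
      rw [h2] at h1
      have h3 : ((Ψ.natDegree - 1 : ℕ) : E) + 1 = ((Ψ.natDegree : ℕ) : E) := by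
        rw [← h2]; push_cast; simp
      rw [h3] at h1
      rcases mul_eq_zero.1 h1 with h4 | h4
      · have : Ψ = 0 := by simpa using h4
        rw [this] at hne; simp at hne
      · rw [CharP.cast_eq_zero_iff E p] at h4
        have := Nat.le_of_dvd (by omega) h4
        omega
    rw [Polynomial.eq_C_of_natDegree_eq_zero hconst] at h0 ⊢
    simpa using h0

/-- the inflection polynomial -/
noncomputable def infl {K : Type*} [Field K] (F : MvPolynomial (Fin 3) K) : MvPolynomial (Fin 3) K :=
  pderiv 0 F * pderiv 0 F * pderiv 2 (pderiv 2 F) - pderiv 2 F * pderiv 0 F * pderiv 0 (pderiv 2 F)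
   - pderiv 2 F * pderiv 0 F * pderiv 2 (pderiv 0 F) + pderiv 2 F * pderiv 2 F * pderiv 0 (pderiv 0 F)

lemma snd_aeval {K E : Type*} [Field K] [Field E] [Algebra K E] (ι : MvPolynomial (Fin 3) K →ₐ[K] E)
    (β : E) (g : MvPolynomial (Fin 3) K) :
    (aeval (R := K) ![TrivSqZeroExt.inl (ι (X 0)) - TrivSqZeroExt.inr β, TrivSqZeroExt.inl (ι (X 1)),
      TrivSqZeroExt.inl (ι (X 2)) + DualNumber.eps] g : DualNumber E) =
      TrivSqZeroExt.inl (ι g) + TrivSqZeroExt.inr (ι (pderiv 2 g) - β * ι (pderiv 0 g)) := by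
  induction g using MvPolynomial.induction_on with
  | C a =>
    simp [algHom_C, TrivSqZeroExt.algebraMap_eq_inl]
    rfl
  | add f g hf hg =>
    rw [map_add, hf, hg]
    ext <;> simp; ring
  | mul_X f i hf =>
    rw [map_mul, hf]
    fin_cases i
    · ext <;> simp [pderiv_X, Pi.single_apply]; ring
    · ext <;> simp [pderiv_X, Pi.single_apply]; ring
    · ext <;> simp [pderiv_X, Pi.single_apply, DualNumber.fst_eps, DualNumber.snd_eps]; ring

lemma ruled {K : Type*} [Field K] (p : ℕ) [Fact p.Prime] [CharP K p]
    {E : Type*} [Field E] [Algebra K E] (F : MvPolynomial (Fin 3) K) (hd : F.totalDegree < p)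
    (ι : MvPolynomial (Fin 3) K →ₐ[K] E) (hι : ∀ g, ι g = 0 ↔ F ∣ g)
    (hfrac : ∀ x : E, ∃ g h, ι h ≠ 0 ∧ x * ι h = ι g)
    (hFv : ι (pderiv 0 F) ≠ 0) (hH : F ∣ infl F) (β : E) (hβ : β * ι (pderiv 0 F) = ι (pderiv 2 F))
    (T : E) : aeval ![ι (X 0) + β * ι (X 2) - β * T, ι (X 1), T] F = 0 := by
  haveI : CharP E p := charP_of_injective_algebraMap (algebraMap K E).injective p
  let τ : MvPolynomial (Fin 3) K →ₐ[K] DualNumber E :=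
    aeval (R := K) ![TrivSqZeroExt.inl (ι (X 0)) - TrivSqZeroExt.inr β, TrivSqZeroExt.inl (ι (X 1)),
      TrivSqZeroExt.inl (ι (X 2)) + DualNumber.eps]
  have hτ : ∀ g, τ g = TrivSqZeroExt.inl (ι g) + TrivSqZeroExt.inr (ι (pderiv 2 g) - β * ι (pderiv 0 g)) :=
    snd_aeval ι β
  have hker : ∀ g, ι g = 0 → τ g = 0 := by
    intro g hg
    obtain ⟨q, rfl⟩ := (hι g).1 hg
    have hF0 : ι F = 0 := (hι F).2 dvd_rfl
    rw [map_mul, hτ F, hF0, hβ]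
    simp
  let D := ι.range
  -- factor through the range
  let τD : ι.range →+* DualNumber E :=
    (RingHom.liftOfRightInverse ι.rangeRestrict.toRingHom
      (Function.surjInv ι.rangeRestrict_surjective) (Function.rightInverse_surjInv _)
      ⟨τ.toRingHom, by
        intro g hg
        apply hker
        have : ι.rangeRestrict g = 0 := hg
        exact congrArg Subtype.val this⟩)
  have hτD : ∀ g, τD (ι.rangeRestrict g) = τ g := by
    intro g
    exact RingHom.liftOfRightInverse_comp_apply _ _ _ _ g
  haveI : IsFractionRing ι.range E := by
    refine IsFractionRing.of_field _ _ ?_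
    intro z
    obtain ⟨g, h, hh, e⟩ := hfrac z
    refine ⟨ι.rangeRestrict g, ι.rangeRestrict h, ?_⟩
    change z = ι g / ι h
    rw [eq_div_iff hh, e]
  let σ : E →+* DualNumber E := IsLocalization.lift (M := nonZeroDivisors ι.range) (g := τD) (by
    rintro ⟨⟨y, ⟨g, rfl⟩⟩, hy⟩
    have h1 := hτD g
    change IsUnit (τD (ι.rangeRestrict g))
    rw [h1, hτ]
    rw [TrivSqZeroExt.isUnit_iff_isUnit_fst]
    simp only [TrivSqZeroExt.fst_add, TrivSqZeroExt.fst_inl, TrivSqZeroExt.fst_inr, add_zero]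
    rw [isUnit_iff_ne_zero]
    intro h0
    exact nonZeroDivisors.ne_zero hy (Subtype.ext h0))
  have hσ : ∀ g, σ (ι g) = τ g := by
    intro g
    rw [← hτD]
    exact IsLocalization.lift_eq (M := nonZeroDivisors ι.range) (S := E) _ (ι.rangeRestrict g)
  have hσu : σ (ι (X 2)) = TrivSqZeroExt.inl (ι (X 2)) + DualNumber.eps := by
    rw [hσ]; simp [τ]
  have hσv : σ (ι (X 0)) = TrivSqZeroExt.inl (ι (X 0)) - TrivSqZeroExt.inr β := by
    rw [hσ]; simp [τ]
  have hσw : σ (ι (X 1)) = TrivSqZeroExt.inl (ι (X 1)) := by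
    rw [hσ]; simp [τ]
  have hσβ : σ β = TrivSqZeroExt.inl β := by
    have h1 : σ β * σ (ι (pderiv 0 F)) = σ (ι (pderiv 2 F)) := by rw [← map_mul, hβ]
    have h2 : TrivSqZeroExt.inl β * σ (ι (pderiv 0 F)) = σ (ι (pderiv 2 F)) := by
      rw [hσ, hσ, hτ, hτ]
      have hH0 : ι (infl F) = 0 := (hι _).2 hH
      simp only [infl, map_add, map_sub, map_mul] at hH0
      rw [← hβ] at hH0
      have h3 : ι (pderiv 2 (pderiv 2 F)) - β * ι (pderiv 0 (pderiv 2 F))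
         - β * ι (pderiv 2 (pderiv 0 F)) + β * β * ι (pderiv 0 (pderiv 0 F)) = 0 := by
        have : ι (pderiv 0 F) * ι (pderiv 0 F) * (ι (pderiv 2 (pderiv 2 F)) - β * ι (pderiv 0 (pderiv 2 F))
         - β * ι (pderiv 2 (pderiv 0 F)) + β * β * ι (pderiv 0 (pderiv 0 F))) = 0 := by
          rw [← hH0]; ring
        rcases mul_eq_zero.1 this with h | h
        · rcases mul_eq_zero.1 h with h | h <;> exact absurd h hFv
        · exact h
      ext
      · simp [hβ]
      · simp
        linear_combination -h3
    have hun : IsUnit (σ (ι (pderiv 0 F))) := (isUnit_iff_ne_zero.2 hFv).map σ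
    exact hun.mul_right_cancel (h1.trans h2.symm)
  set α := ι (X 0) + β * ι (X 2) with hα
  have hσα : σ α = TrivSqZeroExt.inl α := by
    rw [hα, map_add, map_mul, hσv, hσβ, hσu]
    ext <;> simp
  let Ψ : Polynomial E := aeval ![Polynomial.C α - Polynomial.C β * Polynomial.X, Polynomial.C (ι (X 1)), Polynomial.X] F
  have hΨev : ∀ T : E, Ψ.eval T = aeval ![α - β * T, ι (X 1), T] F := by
    intro T
    have : ((Polynomial.aeval T : Polynomial E →ₐ[E] E).restrictScalars K).comp (aeval ![Polynomial.C α - Polynomial.C β * Polynomial.X, Polynomial.C (ι (X 1)), Polynomial.X])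
       = aeval ![α - β * T, ι (X 1), T] := by
      apply MvPolynomial.algHom_ext
      intro i
      fin_cases i <;> simp
    have h2 := congrArg (fun h => h F) this
    simpa [Ψ, Polynomial.aeval_def, Polynomial.eval₂_eq_eval_map] using h2
  have hΨ0 : Ψ = 0 := by
    apply poly_const_zero p σ (ι (X 2)) hσu F.totalDegree Ψ
    · have := MvPolynomial.aeval_natDegree_le (MvPolynomial.map (algebraMap K E) F) (m := F.totalDegree) (Finset.sup_mono (support_map_subset _ _))
        (![Polynomial.C α - Polynomial.C β * Polynomial.X, Polynomial.C (ι (X 1)), Polynomial.X] : Fin 3 → Polynomial E)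
        (n := 1) (by
          intro i
          fin_cases i
          · simp only [Fin.zero_eta, Fin.isValue, Matrix.cons_val_zero]; compute_degree
          · simp
          · simp)
      rw [MvPolynomial.aeval_map_algebraMap] at this
      simpa [Ψ] using this
    · exact hd
    · have hmap : ((Polynomial.mapRingHom σ).comp (aeval (R := K) ![Polynomial.C α - Polynomial.C β * Polynomial.X, Polynomial.C (ι (X 1)), Polynomial.X] : MvPolynomial (Fin 3) K →ₐ[K] Polynomial E).toRingHom)
         = ((Polynomial.mapRingHom (TrivSqZeroExt.inlHom E E)).comp (aeval (R := K) ![Polynomial.C α - Polynomial.C β * Polynomial.X, Polynomial.C (ι (X 1)), Polynomial.X] : MvPolynomial (Fin 3) K →ₐ[K] Polynomial E).toRingHom) := by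
        apply MvPolynomial.ringHom_ext
        · intro c
          have : σ (algebraMap K E c) = TrivSqZeroExt.inl (algebraMap K E c) := by
            have h1 : algebraMap K E c = ι (C c) := by rw [algHom_C]
            rw [h1, hσ, hτ]; simp
          simp [Polynomial.algebraMap_apply, this]
        · intro i
          fin_cases i <;> simp [hσα, hσβ, hσw]
      intro i
      have := congrArg (fun h => (h F).coeff i) hmap
      simpa [Ψ] using this
    · rw [hΨev]
      have : (![α - β * ι (X 2), ι (X 1), ι (X 2)] : Fin 3 → E) = fun i => ι (X i) := by
        funext i; fin_cases i <;> simp [hα]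
      rw [this]
      have h2 : aeval (fun i => ι (X i)) = ι := by
        apply MvPolynomial.algHom_ext; intro i; simp
      rw [h2]
      exact (hι F).2 dvd_rfl
  rw [← hΨev, hΨ0]; simp
end Rud


namespace Rud
open MvPolynomial

lemma val_exists {P E Q : Type*} [CommRing P] [Field E] [CommRing Q] [IsDomain Q]
    (ι : P →+* E) (φ : P →+* Q) (h : ∀ g, ι g = 0 → φ g = 0) :
    ∃ A : ValuationSubring E, ∀ g, (φ g ≠ 0 → A.valuation (ι g) = 1) ∧
      (φ g = 0 → A.valuation (ι g) < 1) := by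
  haveI : (RingHom.ker φ).IsPrime := RingHom.ker_isPrime φ
  let R := Localization.AtPrime (RingHom.ker φ)
  have hu : ∀ y : (RingHom.ker φ).primeCompl, IsUnit (ι y) := by
    rintro ⟨y, hy⟩
    rw [isUnit_iff_ne_zero]
    intro h0
    exact hy (h y h0)
  let f : R →+* E := IsLocalization.lift (M := (RingHom.ker φ).primeCompl) hu
  have hf : ∀ g, f (algebraMap P R g) = ι g := fun g => IsLocalization.lift_eq _ g
  obtain ⟨A, hA, hloc⟩ := IsLocalRing.exists_factor_valuationRing f
  refine ⟨A, fun g => ⟨fun hg => ?_, fun hg => ?_⟩⟩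
  · have h1 : IsUnit (algebraMap P R g) :=
      IsLocalization.map_units R (⟨g, hg⟩ : (RingHom.ker φ).primeCompl)
    have h2 := h1.map (f.codRestrict A.toSubring hA)
    have h3 := (A.valuation_eq_one_iff _).1 h2
    rw [← hf]; exact h3
  · have h1 : ¬ IsUnit (algebraMap P R g) := by
      rw [IsLocalization.AtPrime.isUnit_to_map_iff R (RingHom.ker φ)]
      intro h; exact h hg
    have h2 : ¬ IsUnit (f.codRestrict A.toSubring hA (algebraMap P R g)) := fun h => h1 (hloc.map_nonunit _ h)
    have h3 := (A.valuation_lt_one_iff (f.codRestrict A.toSubring hA (algebraMap P R g))).1 h2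
    rw [← hf]; exact h3

lemma root_val_le {R E Γ : Type*} [CommRing R] [Field E] [LinearOrderedCommGroupWithZero Γ]
    (v : Valuation E Γ) (j : R →+* E) (hj : ∀ c, c ≠ 0 → v (j c) = 1) (M : Polynomial R) (hM : M ≠ 0)
    (y : E) (hy : M.eval₂ j y = 0) : v y ≤ 1 := by
  by_contra hlt
  push Not at hlt
  rw [Polynomial.eval₂_eq_sum_range, Finset.sum_range_succ] at hy
  have hle : ∀ c, v (j c) ≤ 1 := by
    intro c
    by_cases hc : c = 0
    · simp [hc]
    · exact (hj c hc).le
  have hy0 : v y ≠ 0 := (lt_trans zero_lt_one hlt).ne'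
  have h1 : v (∑ x ∈ Finset.range M.natDegree, j (M.coeff x) * y ^ x) < v y ^ M.natDegree := by
    apply Valuation.map_sum_lt v (pow_ne_zero _ hy0)
    intro i hi
    rw [map_mul, map_pow]
    calc v (j (M.coeff i)) * v y ^ i ≤ 1 * v y ^ i := by gcongr; exact hle _
      _ = v y ^ i := one_mul _
      _ < v y ^ M.natDegree := pow_lt_pow_right₀ hlt (Finset.mem_range.1 hi)
  have h2 : ∑ x ∈ Finset.range M.natDegree, j (M.coeff x) * y ^ x = - (j (M.coeff M.natDegree) * y ^ M.natDegree) :=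
    eq_neg_of_add_eq_zero_left hy
  rw [h2, Valuation.map_neg, map_mul, hj _ (by simpa using hM), one_mul, map_pow] at h1
  exact lt_irrefl _ h1

lemma root_val_eq {R E Γ : Type*} [CommRing R] [Field E] [LinearOrderedCommGroupWithZero Γ]
    (v : Valuation E Γ) (j : R →+* E) (hj : ∀ c, c ≠ 0 → v (j c) = 1) (M : Polynomial R) (hM : M ≠ 0)
    (y : E) (hy : M.eval₂ j y = 0) (hy1 : v y < 1) : y = 0 := by
  by_contra h0
  letI := invertibleOfNonzero h0
  have h1 := (Polynomial.eval₂_reverse_eq_zero_iff j y M).2 hy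
  have h2 := root_val_le v j hj _ (by simpa using hM) _ h1
  rw [invOf_eq_inv, map_inv₀] at h2
  have hy0 : v y ≠ 0 := by simpa using h0
  have := (one_lt_inv₀ (zero_lt_iff.2 hy0)).2 hy1
  exact absurd h2 (not_le.2 this)

lemma M_ne_zero {K : Type*} [Field K] (F : MvPolynomial (Fin 3) K) (hF : Irreducible F)
    (hFv : pderiv 0 F ≠ 0) (ξ η : K) (hξ : ξ ≠ 0) :
    (aeval (R := K) ![Polynomial.X, Polynomial.C Polynomial.X,
      Polynomial.C (Polynomial.C ξ⁻¹ * (Polynomial.C η - Polynomial.X))] F :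
        Polynomial (Polynomial K)) ≠ 0 := by
  intro h0
  set ψ : MvPolynomial (Fin 3) K →ₐ[K] Polynomial (Polynomial K) := aeval (R := K) ![Polynomial.X, Polynomial.C Polynomial.X,
      Polynomial.C (Polynomial.C ξ⁻¹ * (Polynomial.C η - Polynomial.X))] with hψ
  let l : MvPolynomial (Fin 3) K := C ξ * X 2 + X 1 - C η
  let s : Polynomial (Polynomial K) →+* MvPolynomial (Fin 3) K :=
    Polynomial.eval₂RingHom (Polynomial.aeval (X 1 : MvPolynomial (Fin 3) K)).toRingHom (X 0)
  let mk := Ideal.Quotient.mk (Ideal.span {l})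
  have hmkl : mk l = 0 := Ideal.Quotient.eq_zero_iff_mem.2 (Ideal.mem_span_singleton_self l)
  have hcc : (C ξ : MvPolynomial (Fin 3) K) * C ξ⁻¹ = 1 := by rw [← C_mul, mul_inv_cancel₀ hξ, C_1]
  have hcomp : (mk.comp s).comp ψ.toRingHom = mk := by
    apply MvPolynomial.ringHom_ext
    · intro c
      simp [s, MvPolynomial.algebraMap_eq]
    · intro i
      fin_cases i
      · simp [s, ψ]
      · simp [s, ψ]
      · have e : mk (X 2) = mk (C ξ⁻¹ * (C η - X 1)) + mk (C ξ⁻¹) * mk l := by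
          rw [← map_mul, ← map_add]
          congr 1
          simp only [l]
          linear_combination (-X 2 : MvPolynomial (Fin 3) K) * hcc
        rw [hmkl, mul_zero, add_zero] at e
        simp [s, ψ, MvPolynomial.algebraMap_eq] at e ⊢
        exact e.symm
  have h1 : mk F = 0 := by
    rw [← hcomp]
    change mk (s (ψ F)) = 0
    rw [h0]; simp
  have hdvd : l ∣ F := Ideal.mem_span_singleton.1 (Ideal.Quotient.eq_zero_iff_mem.1 h1)
  have hl : ψ l = 0 := by
    simp only [l, ψ, map_sub, map_add, map_mul, aeval_X, algHom_C]
    simp [Polynomial.algebraMap_apply]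
    rw [← mul_assoc, ← Polynomial.C_mul, ← Polynomial.C_mul, mul_inv_cancel₀ hξ]
    simp
  have hlu : ¬ IsUnit l := by
    intro h
    have := h.map ψ
    rw [hl] at this
    exact not_isUnit_zero this
  obtain ⟨c, hc⟩ := hdvd
  have hcu : IsUnit c := (hF.isUnit_or_isUnit hc).resolve_left hlu
  obtain ⟨k, -, hk⟩ := (MvPolynomial.isUnit_iff_eq_C_of_isReduced).1 hcu
  apply hFv
  rw [hc, hk]
  simp [l, pderiv_X]

lemma Rprime_abs {K : Type*} [Field K] (p : ℕ) [Fact p.Prime] [CharP K p]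
    {E : Type*} [Field E] [Algebra K E] (F : MvPolynomial (Fin 3) K) (hF : Irreducible F)
    (hd : F.totalDegree < p)
    (ι : MvPolynomial (Fin 3) K →ₐ[K] E) (hι : ∀ g, ι g = 0 ↔ F ∣ g)
    (hfrac : ∀ x : E, ∃ g h, ι h ≠ 0 ∧ x * ι h = ι g)
    (hFv : ι (pderiv 0 F) ≠ 0) (hH : F ∣ infl F) (ξ η ζ : K) (hξ : ξ ≠ 0)
    (hB : lineB ξ η ζ F = 0) :
    F ∣ C ξ * pderiv 0 F * (X 0 - C ζ) + pderiv 2 F * (C ξ * X 2 + X 1 - C η) := by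
  obtain ⟨β, hβ⟩ : ∃ β, β * ι (pderiv 0 F) = ι (pderiv 2 F) := ⟨_, div_mul_cancel₀ _ hFv⟩
  have hru := ruled p F hd ι hι hfrac hFv hH β hβ
  have hFv0 : pderiv 0 F ≠ 0 := by intro h; rw [h] at hFv; simp at hFv
  let a := algebraMap K E
  have haξ : a ξ ≠ 0 := by simpa [a] using hξ
  let φ : MvPolynomial (Fin 3) K →ₐ[K] Polynomial K :=
    aeval ![Polynomial.C ζ, Polynomial.X, Polynomial.C ξ⁻¹ * (Polynomial.C η - Polynomial.X)]
  have hφ : ∀ g, φ g = (Polynomial.aeval (Polynomial.C ξ⁻¹ * (Polynomial.C η - Polynomial.X)) (lineB ξ η ζ g)) := by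
    intro g
    have : φ = (Polynomial.aeval (Polynomial.C ξ⁻¹ * (Polynomial.C η - Polynomial.X))).comp (lineB ξ η ζ) := by
      apply MvPolynomial.algHom_ext
      intro i
      fin_cases i
      · simp [φ, lineB, Polynomial.algebraMap_eq]
      · simp [φ, lineB, Polynomial.algebraMap_eq]
        rw [← mul_assoc, ← Polynomial.C_mul, mul_inv_cancel₀ hξ]
        simp
      · simp [φ, lineB, Polynomial.algebraMap_eq]
    rw [this]; rfl
  obtain ⟨A, hA⟩ := val_exists ι.toRingHom φ.toRingHom (by
    intro g hg
    obtain ⟨q, rfl⟩ := (hι g).1 hg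
    change φ _ = 0
    rw [map_mul, hφ F, hB]; simp)
  set v := A.valuation
  have hA1 : ∀ g, φ g ≠ 0 → v (ι g) = 1 := fun g => (hA g).1
  have hA2 : ∀ g, φ g = 0 → v (ι g) < 1 := fun g => (hA g).2
  let j : Polynomial K →+* E := (Polynomial.aeval (ι (X 1))).toRingHom
  have hj : ∀ c, c ≠ 0 → v (j c) = 1 := by
    intro c hc
    have h1 : j c = ι (Polynomial.aeval (X 1) c) := by
      simp [j, Polynomial.aeval_algHom_apply]
    rw [h1]
    apply hA1
    rw [← Polynomial.aeval_algHom_apply]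
    simpa [φ] using hc
  let α : E := ι (X 0) + β * ι (X 2)
  let U : K → E := fun η' => (a ξ)⁻¹ * (a η' - ι (X 1))
  let M : K → Polynomial (Polynomial K) := fun η' => aeval (R := K) ![Polynomial.X, Polynomial.C Polynomial.X,
      Polynomial.C (Polynomial.C ξ⁻¹ * (Polynomial.C η' - Polynomial.X))] F
  have hM : ∀ η', M η' ≠ 0 := fun η' => M_ne_zero F hF hFv0 ξ η' hξ
  have hroot : ∀ η', (M η').eval₂ j (α - β * U η') = 0 := by
    intro η'
    rw [← hru (U η')]
    have : (Polynomial.eval₂RingHom j (α - β * U η')).comp (aeval (R := K) ![Polynomial.X, Polynomial.C Polynomial.X,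
      Polynomial.C (Polynomial.C ξ⁻¹ * (Polynomial.C η' - Polynomial.X))] : MvPolynomial (Fin 3) K →ₐ[K] Polynomial (Polynomial K)).toRingHom
       = (aeval (R := K) ![α - β * U η', ι (X 1), U η'] : MvPolynomial (Fin 3) K →ₐ[K] E).toRingHom := by
      apply MvPolynomial.ringHom_ext
      · intro c
        simp [j, Polynomial.algebraMap_apply]
      · intro i
        fin_cases i
        · simp
        · simp [j]
        · simp [j, U, a]
    exact congrArg (fun h => h F) this
  have hy : ∀ η', v (α - β * U η') ≤ 1 := fun η' => root_val_le v j hj _ (hM η') _ (hroot η')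
  have hvβ : v β ≤ 1 := by
    have h1 : β = (α - β * U η) - (α - β * U (η + ξ)) := by
      have : U (η + ξ) = U η + 1 := by
        simp only [U, map_add]
        field_simp
        ring
      rw [this]; ring
    rw [h1]
    exact (v.map_sub _ _).trans (max_le (hy _) (hy _))
  have hα0 : (α - β * U η) - a ζ = 0 := by
    apply root_val_eq v j hj ((M η).comp (Polynomial.X + Polynomial.C (Polynomial.C ζ)))
    · intro h
      exact hM η (Polynomial.comp_X_add_C_eq_zero_iff.1 h)
    · rw [Polynomial.eval₂_comp]
      have : Polynomial.eval₂ j (α - β * U η - a ζ) (Polynomial.X + Polynomial.C (Polynomial.C ζ)) = α - β * U η := by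
        simp [j, a]
      rw [this]; exact hroot η
    · have e : α - β * U η - a ζ = ι (X 0 - C ζ) + β * ι (X 2 - C ξ⁻¹ * (C η - X 1)) := by
        simp [α, U, a, algHom_C]; ring
      rw [e]
      refine Valuation.map_add_lt v ?_ ?_
      · apply hA2; simp [φ, algHom_C, Polynomial.algebraMap_eq]
      · rw [map_mul]
        have : v (ι (X 2 - C ξ⁻¹ * (C η - X 1))) < 1 := by
          apply hA2; simp [φ, algHom_C, Polynomial.algebraMap_eq]
        calc _ ≤ 1 * v (ι (X 2 - C ξ⁻¹ * (C η - X 1))) := by gcongr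
          _ < 1 := by rwa [one_mul]
  rw [← hι]
  simp only [map_add, map_sub, map_mul, algHom_C]
  rw [← hβ]
  have : (a ξ) * (a ξ)⁻¹ = 1 := mul_inv_cancel₀ haξ
  simp only [α, U, a] at hα0 this ⊢
  linear_combination (ι (pderiv 0 F)) * (algebraMap K E ξ) * hα0 + β * ι (pderiv 0 F) * (algebraMap K E η - ι (X 1)) * this

lemma Rprime {K : Type*} [Field K] (p : ℕ) [Fact p.Prime] [CharP K p]
    (F : MvPolynomial (Fin 3) K) (hF : Irreducible F)
    (hd : F.totalDegree < p)
    (hFv : ¬ F ∣ pderiv 0 F) (hH : F ∣ infl F) (ξ η ζ : K) (hξ : ξ ≠ 0)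
    (hB : lineB ξ η ζ F = 0) :
    F ∣ C ξ * pderiv 0 F * (X 0 - C ζ) + pderiv 2 F * (C ξ * X 2 + X 1 - C η) := by
  let I := Ideal.span {F}
  haveI : I.IsPrime := (Ideal.span_singleton_prime hF.ne_zero).2 hF.prime
  let D := MvPolynomial (Fin 3) K ⧸ I
  let E := FractionRing D
  let ι : MvPolynomial (Fin 3) K →ₐ[K] E := (IsScalarTower.toAlgHom K D E).comp (Ideal.Quotient.mkₐ K I)
  have hιe : ∀ g, ι g = algebraMap D E (Ideal.Quotient.mk I g) := fun g => rfl
  have hι : ∀ g, ι g = 0 ↔ F ∣ g := by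
    intro g
    rw [hιe, FaithfulSMul.algebraMap_eq_zero_iff, Ideal.Quotient.eq_zero_iff_mem]
    exact Ideal.mem_span_singleton
  refine Rprime_abs p F hF hd ι hι ?_ ?_ hH ξ η ζ hξ hB
  · intro x
    obtain ⟨⟨n, d⟩, h⟩ := IsLocalization.surj (nonZeroDivisors D) x
    obtain ⟨g, rfl⟩ := Ideal.Quotient.mk_surjective n
    obtain ⟨d, hd⟩ := d
    obtain ⟨g', rfl⟩ := Ideal.Quotient.mk_surjective d
    refine ⟨g, g', ?_, h⟩
    rw [hιe, Ne, FaithfulSMul.algebraMap_eq_zero_iff]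
    exact nonZeroDivisors.ne_zero hd
  · rwa [Ne, hι]
end Rud


namespace Rud
open MvPolynomial

lemma card_roots_le {K ι : Type*} [Field K] (q : Polynomial K) (hq : q ≠ 0) (d : ℕ) (hd : q.natDegree ≤ d)
    (S : Finset ι) (g : ι → K) (hg : Set.InjOn g S) (hr : ∀ a ∈ S, q.eval (g a) = 0) : S.card ≤ d := by
  classical
  rw [← Finset.card_image_of_injOn hg]
  refine le_trans ?_ (q.card_roots'.trans hd)
  refine le_trans (Finset.card_le_card ?_) (Multiset.toFinset_card_le _)
  intro x hx
  obtain ⟨a, ha, rfl⟩ := Finset.mem_image.1 hx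
  simp [hq, hr a ha]

lemma lineA_eval {K : Type*} [Field K] (ξ η ζ u : K) (F : MvPolynomial (Fin 3) K) :
    (lineA ξ η ζ F).eval u = eval ![η - ξ * u, ζ, u] F := by
  have : ((Polynomial.aeval u).comp (lineA ξ η ζ)) = aeval ![η - ξ * u, ζ, u] := by
    apply MvPolynomial.algHom_ext
    intro i
    fin_cases i <;> simp [lineA]
  have h := congrArg (fun h => h F) this
  simpa [MvPolynomial.aeval_eq_eval] using h

lemma lineB_eval {K : Type*} [Field K] (ξ η ζ u : K) (F : MvPolynomial (Fin 3) K) :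
    (lineB ξ η ζ F).eval u = eval ![ζ, η - ξ * u, u] F := by
  have : ((Polynomial.aeval u).comp (lineB ξ η ζ)) = aeval ![ζ, η - ξ * u, u] := by
    apply MvPolynomial.algHom_ext
    intro i
    fin_cases i <;> simp [lineB]
  have h := congrArg (fun h => h F) this
  simpa [MvPolynomial.aeval_eq_eval] using h

lemma meet {K : Type*} [Field K] (ξ η ζ ξ' η' ζ' : K) (h : ξ ≠ 0) (h' : ξ' ≠ 0)
    (hinc : ξ * (η' - ζ) = ξ' * (η - ζ')) (F : MvPolynomial (Fin 3) K) :
    (lineA ξ η ζ F).eval ((η - ζ') / ξ) = (lineB ξ' η' ζ' F).eval ((η - ζ') / ξ) ∧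
     (η - ζ') / ξ = (η' - ζ) / ξ' := by
  have e : (η - ζ') / ξ = (η' - ζ) / ξ' := by
    rw [div_eq_div_iff h h']; linear_combination -hinc
  refine ⟨?_, e⟩
  rw [lineA_eval, lineB_eval]
  have e1 : η - ξ * ((η - ζ') / ξ) = ζ' := by field_simp; ring
  have e2 : η' - ξ' * ((η - ζ') / ξ) = ζ := by rw [e]; field_simp; ring
  rw [e1, e2]

lemma lineA_deriv {K : Type*} [Field K] (ξ η ζ : K) (F : MvPolynomial (Fin 3) K) :
    (lineA ξ η ζ F).derivative = lineA ξ η ζ (pderiv 2 F) - Polynomial.C ξ * lineA ξ η ζ (pderiv 0 F) := by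
  induction F using MvPolynomial.induction_on with
  | C a => simp [algHom_C, Polynomial.algebraMap_eq]
  | add f g hf hg => simp only [map_add, hf, hg]; ring
  | mul_X f i hf =>
    rw [map_mul, Polynomial.derivative_mul, hf]
    fin_cases i
    · simp [pderiv_X, Pi.single_apply, lineA]; ring
    · simp [pderiv_X, Pi.single_apply, lineA]; ring
    · simp [pderiv_X, Pi.single_apply, lineA]; ring

lemma lineA_rel {K : Type*} [Field K] (ξ η ζ : K) (F : MvPolynomial (Fin 3) K) (h : lineA ξ η ζ F = 0) :
    lineA ξ η ζ (pderiv 2 F) = Polynomial.C ξ * lineA ξ η ζ (pderiv 0 F) := by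
  have := lineA_deriv ξ η ζ F
  rw [h, Polynomial.derivative_zero] at this
  exact (sub_eq_zero.1 this.symm)

lemma lineA_C {K : Type*} [Field K] (ξ η ζ c : K) : lineA ξ η ζ (C c) = Polynomial.C c := by
  simp [algHom_C, Polynomial.algebraMap_eq]

lemma lineA_infl {K : Type*} [Field K] (ξ η ζ : K) (F : MvPolynomial (Fin 3) K) (h : lineA ξ η ζ F = 0) :
    lineA ξ η ζ (infl F) = 0 := by
  have h1 := lineA_rel ξ η ζ F h
  have h2 : lineA ξ η ζ (pderiv 2 F - C ξ * pderiv 0 F) = 0 := by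
    rw [map_sub, map_mul, h1, lineA_C]; ring
  have h3 := lineA_rel ξ η ζ _ h2
  simp only [map_sub, Derivation.leibniz, pderiv_C, smul_eq_mul, mul_zero, add_zero, map_mul, lineA_C] at h3
  simp only [infl, map_add, map_sub, map_mul, h1]
  linear_combination (lineA ξ η ζ (pderiv 0 F))^2 * h3

lemma totalDegree_pderiv {K : Type*} [Field K] (i : Fin 3) (F : MvPolynomial (Fin 3) K) :
    (pderiv i F).totalDegree ≤ F.totalDegree - 1 := by
  classical
  refine Finset.sup_le fun m hm => ?_
  rw [mem_support_iff, coeff_pderiv] at hm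
  have h1 := le_totalDegree (mem_support_iff.2 (left_ne_zero_of_mul hm))
  rw [Finsupp.sum_fintype _ _ (by simp)] at h1 ⊢
  have h2 : ∑ j, (m + Finsupp.single i 1 : Fin 3 →₀ ℕ) j = ∑ j, m j + 1 := by
    simp [Finset.sum_add_distrib, Finsupp.single_apply]
  omega

lemma infl_totalDegree {K : Type*} [Field K] (F : MvPolynomial (Fin 3) K) :
    (infl F).totalDegree ≤ 3 * F.totalDegree := by
  have h := fun i G => (totalDegree_pderiv (K := K) i G)
  have hm : ∀ (i j k l : Fin 3), (pderiv i F * pderiv j F * pderiv k (pderiv l F)).totalDegree ≤ 3 * F.totalDegree := by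
    intro i j k l
    refine (totalDegree_mul _ _).trans ?_
    have := totalDegree_mul (pderiv i F) (pderiv j F)
    have h1 := h i F
    have h2 := h j F
    have h3 := h l F
    have h4 := h k (pderiv l F)
    omega
  unfold infl
  refine (totalDegree_add _ _).trans (max_le ?_ (hm _ _ _ _))
  refine (totalDegree_sub _ _).trans (max_le ?_ (hm _ _ _ _))
  exact (totalDegree_sub _ _).trans (max_le (hm _ _ _ _) (hm _ _ _ _))

lemma not_dvd_of_lt {K : Type*} [Field K] (F G : MvPolynomial (Fin 3) K) (hG : G ≠ 0)
    (h : G.totalDegree < F.totalDegree) : ¬ F ∣ G := by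
  rintro ⟨c, rfl⟩
  rw [totalDegree_mul_of_isDomain (left_ne_zero_of_mul hG) (right_ne_zero_of_mul hG)] at h
  omega

lemma irr_deg {K : Type*} [Field K] (F : MvPolynomial (Fin 3) K) (hF : Irreducible F) : 1 ≤ F.totalDegree := by
  by_contra h
  have h0 : F.totalDegree = 0 := by omega
  rw [totalDegree_eq_zero_iff_eq_C] at h0
  have : F.coeff 0 ≠ 0 := by
    intro h1; rw [h1] at h0; exact hF.ne_zero (by simpa using h0)
  apply hF.not_isUnit
  rw [h0]
  exact (isUnit_iff_ne_zero.2 this).map C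

lemma exists_vanish {K ι : Type*} [Field K] (ξ η ζ : ι → K) (S : Finset ι) (D : ℕ)
    (h : S.card * (3 * D + 1) < (D + 1) ^ 3) :
    ∃ F : MvPolynomial (Fin 3) K, F ≠ 0 ∧ F.totalDegree ≤ 3 * D ∧
      ∀ a ∈ S, lineA (ξ a) (η a) (ζ a) F = 0 := by
  classical
  let e : (Fin 3 → Fin (D + 1)) → (Fin 3 →₀ ℕ) := fun m => Finsupp.equivFunOnFinite.symm (fun i => (m i : ℕ))
  have he : Function.Injective e := by
    intro m m' h
    funext i
    have := DFunLike.congr_fun h i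
    exact Fin.ext this
  let Φ : ((Fin 3 → Fin (D + 1)) → K) →ₗ[K] MvPolynomial (Fin 3) K :=
    ∑ m, (monomial (e m)).comp (LinearMap.proj m)
  have hΦ : ∀ c, Φ c = ∑ m, monomial (e m) (c m) := by
    intro c; simp [Φ, LinearMap.sum_apply]
  have hdeg : ∀ c, (Φ c).totalDegree ≤ 3 * D := by
    intro c
    rw [hΦ]
    refine totalDegree_finsetSum_le fun m _ => ?_
    refine (totalDegree_monomial_le _ _).trans ?_
    rw [Finsupp.sum_fintype _ _ (by simp)]
    have hh : ∀ i, e m i = m i := fun i => rfl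
    simp only [Fin.sum_univ_three, hh, id]
    have h0 := (m 0).2
    have h1 := (m 1).2
    have h2 := (m 2).2
    omega
  let Ψ : ((Fin 3 → Fin (D + 1)) → K) →ₗ[K] (S × Fin (3 * D + 1) → K) :=
    LinearMap.pi fun x => (Polynomial.lcoeff K x.2).comp
      ((lineA (ξ x.1) (η x.1) (ζ x.1)).toLinearMap.comp Φ)
  have hker : LinearMap.ker Ψ ≠ ⊥ := by
    apply LinearMap.ker_ne_bot_of_finrank_lt
    simpa using h
  obtain ⟨c, hc, hc0⟩ := (Submodule.ne_bot_iff _).1 hker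
  refine ⟨Φ c, ?_, hdeg c, ?_⟩
  · intro h0
    apply hc0
    funext m
    have := congrArg (coeff (e m)) h0
    rw [hΦ, coeff_sum] at this
    simpa [coeff_monomial, he.eq_iff] using this
  · intro a ha
    ext i
    by_cases hi : i < 3 * D + 1
    · have := congrFun (LinearMap.mem_ker.1 hc) (⟨a, ha⟩, ⟨i, hi⟩)
      simpa [Ψ] using this
    · rw [Polynomial.coeff_eq_zero_of_natDegree_lt]; · simp
      have := lineA_natDegree (ξ a) (η a) (ζ a) (Φ c)
      have := hdeg c
      omega

lemma factor_family {K : Type*} [Field K] (F : MvPolynomial (Fin 3) K) (hF : F ≠ 0) :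
    ∃ S : Finset (MvPolynomial (Fin 3) K), (∀ f ∈ S, Irreducible f) ∧
      ∑ f ∈ S, f.totalDegree ≤ F.totalDegree ∧
      ∀ φ : MvPolynomial (Fin 3) K →ₐ[K] Polynomial K, φ F = 0 → ∃ f ∈ S, φ f = 0 := by
  classical
  let s := UniqueFactorizationMonoid.factors F
  have hirr : ∀ f ∈ s, Irreducible f := fun f hf => UniqueFactorizationMonoid.irreducible_of_factor f hf
  obtain ⟨u, hu⟩ := UniqueFactorizationMonoid.factors_prod hF
  have hs0 : s.prod ≠ 0 := by
    intro h; rw [h] at hu; simp at hu; exact hF hu.symm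
  refine ⟨s.toFinset, fun f hf => hirr f (Multiset.mem_toFinset.1 hf), ?_, ?_⟩
  · have h1 : s.prod.totalDegree ≤ F.totalDegree := by
      rw [← hu, totalDegree_mul_of_isDomain hs0 u.isUnit.ne_zero]
      omega
    refine le_trans ?_ h1
    have h2 : ∀ t : Multiset (MvPolynomial (Fin 3) K), (∀ f ∈ t, Irreducible f) →
        t.prod.totalDegree = (t.map totalDegree).sum := by
      intro t
      induction t using Multiset.induction_on with
      | empty => simp
      | cons a t ih =>
        intro ht
        have h3 : t.prod ≠ 0 := by
          apply Multiset.prod_ne_zero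
          intro h0
          exact (ht 0 (Multiset.mem_cons_of_mem h0)).ne_zero rfl
        rw [Multiset.prod_cons, totalDegree_mul_of_isDomain (ht a (Multiset.mem_cons_self a t)).ne_zero h3,
          ih (fun f hf => ht f (Multiset.mem_cons_of_mem hf))]
        simp
    rw [h2 s hirr]
    rw [Finset.sum_multiset_map_count]
    apply Finset.sum_le_sum
    intro f hf
    have : 1 ≤ s.count f := Multiset.one_le_count_iff_mem.2 (Multiset.mem_toFinset.1 hf)
    simpa using Nat.le_mul_of_pos_left _ this
  · intro φ hφ
    rw [← hu, map_mul] at hφ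
    have h1 : φ s.prod = 0 := by
      rcases mul_eq_zero.1 hφ with h | h
      · exact h
      · exact absurd h (u.isUnit.map φ).ne_zero
    rw [map_multiset_prod, Multiset.prod_eq_zero_iff, Multiset.mem_map] at h1
    obtain ⟨f, hf, h⟩ := h1
    exact ⟨f, Multiset.mem_toFinset.2 hf, h⟩

lemma aeval_congr1 {K R : Type*} [Field K] [CommRing R] [Algebra K R] (F : MvPolynomial (Fin 3) K)
    (hF : ∀ m ∈ F.support, m 0 = 0 ∧ m 2 = 0) (g g' : Fin 3 → R) (h : g 1 = g' 1) :
    aeval g F = aeval g' F := by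
  rw [aeval_def, aeval_def, eval₂_eq', eval₂_eq']
  apply Finset.sum_congr rfl
  intro m hm
  obtain ⟨h0, h2⟩ := hF m hm
  simp [Fin.prod_univ_three, h0, h2, h]

lemma pderiv_zero_support {K : Type*} [Field K] (p : ℕ) [Fact p.Prime] [CharP K p]
    (F : MvPolynomial (Fin 3) K) (hd : F.totalDegree < p) (i : Fin 3) (h : pderiv i F = 0) :
    ∀ m ∈ F.support, m i = 0 := by
  classical
  intro m hm
  by_contra hne
  have h1 : m - Finsupp.single i 1 + Finsupp.single i 1 = m := by
    apply tsub_add_cancel_of_le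
    intro j
    by_cases hj : j = i
    · subst hj; simp; omega
    · simp [Finsupp.single_apply, Ne.symm hj]
  have h2 := coeff_pderiv (i := i) F (m - Finsupp.single i 1)
  rw [h, h1, coeff_zero] at h2
  have h3 : (((m - Finsupp.single i 1 : Fin 3 →₀ ℕ) i : ℕ) : K) + 1 = ((m i : ℕ) : K) := by
    have : m i = (m - Finsupp.single i 1 : Fin 3 →₀ ℕ) i + 1 := by simp; omega
    rw [this]; push_cast; rfl
  rw [h3] at h2
  rcases mul_eq_zero.1 h2.symm with h4 | h4
  · exact mem_support_iff.1 hm h4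
  · rw [CharP.cast_eq_zero_iff K p] at h4
    have h5 := Nat.le_of_dvd (by omega) h4
    have h6 := le_totalDegree hm
    rw [Finsupp.sum_fintype _ _ (by simp)] at h6
    have h7 : m i ≤ ∑ j, m j := Finset.single_le_sum (f := fun j => m j) (fun _ _ => Nat.zero_le _) (Finset.mem_univ i)
    omega

lemma bad_count {K ι κ : Type*} [Field K] (p : ℕ) [Fact p.Prime] [CharP K p]
    (F : MvPolynomial (Fin 3) K) (hF : Irreducible F) (hd : F.totalDegree < p)
    (ξ η ζ : ι → K) (S : Finset ι) (hζ : Function.Injective ζ)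
    (ξ' η' ζ' : κ → K) (hξ' : ∀ b, ξ' b ≠ 0) :
    ∃ Bad : Finset ι, Bad ⊆ S ∧ Bad.card ≤ 15 * F.totalDegree ^ 2 ∧
      ∀ a ∈ S, lineA (ξ a) (η a) (ζ a) F = 0 → a ∉ Bad → ∀ b, lineB (ξ' b) (η' b) (ζ' b) F = 0 →
        ξ a * (η' b - ζ a) = ξ' b * (η a - ζ' b) := by
  classical
  have hd1 := irr_deg F hF
  set d := F.totalDegree with hdd
  have hpd : ∀ i, pderiv i F ≠ 0 → ¬ F ∣ pderiv i F := by
    intro i hi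
    apply not_dvd_of_lt _ _ hi
    have := totalDegree_pderiv i F
    omega
  by_cases hinf : F ∣ infl F
  swap
  · refine ⟨S.filter fun a => lineA (ξ a) (η a) (ζ a) F = 0, Finset.filter_subset _ _, ?_, ?_⟩
    · have := elim_count F (infl F) hF hinf d (3 * d) le_rfl (infl_totalDegree F) ξ η ζ
        (S.filter fun a => lineA (ξ a) (η a) (ζ a) F = 0) hζ
        (fun a ha => (Finset.mem_filter.1 ha).2) (fun a ha => lineA_infl _ _ _ _ (Finset.mem_filter.1 ha).2)
      rw [max_eq_right (by omega)] at this
      nlinarith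
    · intro a ha h1 h2
      exact absurd (Finset.mem_filter.2 ⟨ha, h1⟩) h2
  by_cases h0 : pderiv 0 F = 0
  · refine ⟨S.filter fun a => lineA (ξ a) (η a) (ζ a) F = 0, Finset.filter_subset _ _, ?_, ?_⟩
    swap
    · intro a ha h1 h2
      exact absurd (Finset.mem_filter.2 ⟨ha, h1⟩) h2
    by_cases h2 : pderiv 2 F = 0
    · have hsup : ∀ m ∈ F.support, m 0 = 0 ∧ m 2 = 0 := fun m hm =>
        ⟨pderiv_zero_support p F hd 0 h0 m hm, pderiv_zero_support p F hd 2 h2 m hm⟩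
      let q : Polynomial K := aeval ![0, Polynomial.X, 0] F
      have hq0 : q ≠ 0 := by
        intro hq
        apply hF.ne_zero
        have e1 : F = aeval X F := by simp
        have e2 : aeval (X : Fin 3 → MvPolynomial (Fin 3) K) F = aeval ![0, X 1, 0] F :=
          aeval_congr1 F hsup _ _ (by simp)
        have e3 : (Polynomial.aeval (R := K) (X 1 : MvPolynomial (Fin 3) K)).comp (aeval (R := K) ![0, Polynomial.X, 0]) =
            aeval ![0, X 1, 0] := by
          apply MvPolynomial.algHom_ext
          intro i; fin_cases i <;> simp
        rw [e1, e2, ← e3]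
        change Polynomial.aeval _ q = 0
        rw [hq]; simp
      have hqd : q.natDegree ≤ d := by
        have := MvPolynomial.aeval_natDegree_le F (m := F.totalDegree) le_rfl
          (![0, Polynomial.X, 0] : Fin 3 → Polynomial K) (n := 1) (by
            intro i; fin_cases i <;> simp)
        simpa [q] using this
      have := card_roots_le q hq0 d hqd (S.filter fun a => lineA (ξ a) (η a) (ζ a) F = 0) ζ hζ.injOn (by
        intro a ha
        have h1 := (Finset.mem_filter.1 ha).2
        have e1 : lineA (ξ a) (η a) (ζ a) F = aeval ![0, Polynomial.C (ζ a), 0] F :=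
          aeval_congr1 F hsup _ _ (by simp)
        have e3 : (Polynomial.aeval (R := K) (Polynomial.C (ζ a) : Polynomial K)).comp (aeval (R := K) ![0, Polynomial.X, 0]) =
            aeval ![0, Polynomial.C (ζ a), 0] := by
          apply MvPolynomial.algHom_ext
          intro i; fin_cases i <;> simp
        rw [e1, ← e3] at h1
        change Polynomial.aeval (algebraMap K (Polynomial K) (ζ a)) q = 0 at h1
        rw [Polynomial.aeval_algebraMap_apply_eq_algebraMap_eval] at h1
        simpa using h1)
      nlinarith
    · have := elim_count F (pderiv 2 F) hF (hpd 2 h2) d d le_rfl ((totalDegree_pderiv 2 F).trans (by omega)) ξ η ζ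
        (S.filter fun a => lineA (ξ a) (η a) (ζ a) F = 0) hζ
        (fun a ha => (Finset.mem_filter.1 ha).2) (fun a ha => by
          have := lineA_rel _ _ _ _ (Finset.mem_filter.1 ha).2
          rw [this, h0]; simp)
      rw [max_self] at this
      nlinarith
  · refine ⟨S.filter fun a => lineA (ξ a) (η a) (ζ a) F = 0 ∧ lineA (ξ a) (η a) (ζ a) (pderiv 0 F) = 0, Finset.filter_subset _ _, ?_, ?_⟩
    · have := elim_count F (pderiv 0 F) hF (hpd 0 h0) d d le_rfl ((totalDegree_pderiv 0 F).trans (by omega)) ξ η ζ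
        (S.filter fun a => lineA (ξ a) (η a) (ζ a) F = 0 ∧ lineA (ξ a) (η a) (ζ a) (pderiv 0 F) = 0) hζ
        (fun a ha => (Finset.mem_filter.1 ha).2.1) (fun a ha => (Finset.mem_filter.1 ha).2.2)
      rw [max_self] at this
      nlinarith
    · intro a ha h1 h2 b hb
      have h3 : lineA (ξ a) (η a) (ζ a) (pderiv 0 F) ≠ 0 := fun h =>
        h2 (Finset.mem_filter.2 ⟨ha, h1, h⟩)
      obtain ⟨c, hc⟩ := Rprime p F hF hd (hpd 0 h0) hinf _ _ _ (hξ' b) hb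
      have h4 := congrArg (lineA (ξ a) (η a) (ζ a)) hc
      rw [map_mul, h1, zero_mul] at h4
      simp only [map_add, map_sub, map_mul, lineA_C, lineA_rel _ _ _ _ h1] at h4
      have x0 : lineA (ξ a) (η a) (ζ a) (X 0) = Polynomial.C (η a) - Polynomial.C (ξ a) * Polynomial.X := by simp [lineA]
      have x1 : lineA (ξ a) (η a) (ζ a) (X 1) = Polynomial.C (ζ a) := by simp [lineA]
      have x2 : lineA (ξ a) (η a) (ζ a) (X 2) = Polynomial.X := by simp [lineA]
      rw [x0, x1, x2] at h4
      have h5 : lineA (ξ a) (η a) (ζ a) (pderiv 0 F) *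
          Polynomial.C (ξ' b * (η a - ζ' b) - ξ a * (η' b - ζ a)) = 0 := by
        simp only [map_sub, map_mul]
        rw [← h4]; ring
      rcases mul_eq_zero.1 h5 with h | h
      · exact absurd h h3
      · exact (sub_eq_zero.1 (Polynomial.C_eq_zero.1 h)).symm
end Rud


namespace Rud
open MvPolynomial

lemma colour {α β : Type*} [DecidableEq α] (s : α → β → ℤ) (hs : ∀ a b, s a b = 0 ∨ s a b = 1) (A : Finset α) (B : Finset β)
    (T : ℕ) (hT : 0 < T) : ∃ χ : α → Fin T,
    ∑ c, ∑ b ∈ B, (∑ a ∈ A, s a b * (T * (if χ a = c then 1 else 0) - 1)) ^ 2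
      ≤ (T : ℤ) ^ 2 * ∑ a ∈ A, ∑ b ∈ B, s a b := by
  haveI : NeZero T := ⟨hT.ne'⟩
  induction A using Finset.induction_on with
  | empty => exact ⟨fun _ => 0, by simp⟩
  | insert a A ha ih =>
    obtain ⟨χ, hχ⟩ := ih
    set x : Fin T → β → ℤ := fun c b => ∑ a ∈ A, s a b * (T * (if χ a = c then 1 else 0) - 1) with hx
    have hsum : ∑ c0 : Fin T, (∑ c, ∑ b ∈ B, x c b * (s a b * (T * (if c0 = c then 1 else 0) - 1))) ≤ ∑ c0 : Fin T, 0 := by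
      rw [Finset.sum_comm]
      simp only [Finset.sum_const_zero]
      apply le_of_eq
      apply Finset.sum_eq_zero
      intro c _
      rw [Finset.sum_comm]
      apply Finset.sum_eq_zero
      intro b _
      rw [← Finset.mul_sum, ← Finset.mul_sum]
      have : ∑ i : Fin T, ((T : ℤ) * (if i = c then 1 else 0) - 1) = 0 := by
        simp [Finset.sum_sub_distrib, ← Finset.mul_sum]
      rw [this]; simp
    obtain ⟨c0, -, hc0⟩ := Finset.exists_le_of_sum_le (Finset.univ_nonempty) hsum
    refine ⟨Function.update χ a c0, ?_⟩
    have hupd : ∀ c b, ∑ a' ∈ insert a A, s a' b * (T * (if Function.update χ a c0 a' = c then 1 else 0) - 1)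
        = x c b + s a b * (T * (if c0 = c then 1 else 0) - 1) := by
      intro c b
      rw [Finset.sum_insert ha, add_comm]
      congr 1
      · apply Finset.sum_congr rfl
        intro a' ha'
        have : a' ≠ a := fun h => ha (h ▸ ha')
        rw [Function.update_of_ne this]
      · simp
    simp only [hupd]
    rw [Finset.sum_insert ha, mul_add]
    have hexp : ∑ c, ∑ b ∈ B, (x c b + s a b * (T * (if c0 = c then 1 else 0) - 1)) ^ 2
      = ∑ c, ∑ b ∈ B, (x c b) ^ 2 + 2 * (∑ c, ∑ b ∈ B, x c b * (s a b * (T * (if c0 = c then 1 else 0) - 1)))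
        + ∑ c, ∑ b ∈ B, (s a b * (T * (if c0 = c then 1 else 0) - 1)) ^ 2 := by
      simp only [Finset.mul_sum, ← Finset.sum_add_distrib]
      apply Finset.sum_congr rfl; intro c _
      apply Finset.sum_congr rfl; intro b _
      ring
    rw [hexp]
    have h3 : ∑ c, ∑ b ∈ B, (s a b * (T * (if c0 = c then 1 else 0) - 1)) ^ 2 ≤ (T:ℤ) ^ 2 * ∑ b ∈ B, s a b := by
      rw [Finset.sum_comm, Finset.mul_sum]
      apply Finset.sum_le_sum
      intro b _
      have e : ∀ c, (s a b * ((T:ℤ) * (if c0 = c then 1 else 0) - 1)) ^ 2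
          = s a b ^ 2 * ((if c0 = c then (T:ℤ)^2 - 2 * T else 0) + 1) := by
        intro c
        split_ifs <;> ring
      simp only [e]
      rw [← Finset.mul_sum, Finset.sum_add_distrib]
      simp
      have hT' : (1:ℤ) ≤ T := by exact_mod_cast hT
      rcases hs a b with h | h <;> rw [h] <;> nlinarith
    linarith

open Classical in
noncomputable def ed {α β : Type*} (inc : α → β → Prop) (A : Finset α) (B : Finset β) : ℕ :=
  ∑ a ∈ A, ∑ b ∈ B, if inc a b then 1 else 0

open Classical in
lemma ed_eq {α β : Type*} (inc : α → β → Prop) (A : Finset α) (B : Finset β) :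
    ed inc A B = ∑ b ∈ B, (A.filter fun a => inc a b).card := by
  rw [ed, Finset.sum_comm]
  simp only [Finset.card_filter]

open Classical in
lemma ed_eq' {α β : Type*} (inc : α → β → Prop) (A : Finset α) (B : Finset β) :
    ed inc A B = ∑ a ∈ A, (B.filter fun b => inc a b).card := by
  simp only [ed, Finset.card_filter]

lemma ed_mono_left {α β : Type*} (inc : α → β → Prop) {A A' : Finset α} (B : Finset β) (h : A ⊆ A') :
    ed inc A B ≤ ed inc A' B := Finset.sum_le_sum_of_subset h

lemma ed_union_left {α β : Type*} [DecidableEq α] (inc : α → β → Prop) (A A' : Finset α) (B : Finset β) :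
    ed inc (A ∪ A') B ≤ ed inc A B + ed inc A' B := by
  unfold ed
  have := Finset.sum_union_inter (s₁ := A) (s₂ := A') (f := fun a => ∑ b ∈ B, (open Classical in if inc a b then 1 else 0))
  omega

lemma ed_le {α β : Type*} (inc : α → β → Prop) (A : Finset α) (B : Finset β) :
    ed inc A B ≤ A.card * B.card := by
  classical
  rw [ed_eq']
  calc _ ≤ ∑ a ∈ A, B.card := Finset.sum_le_sum fun a _ => Finset.card_filter_le _ _
    _ = _ := by simp

open Classical in
lemma sample {α β : Type*} (inc : α → β → Prop) (A : Finset α) (B : Finset β) (T d : ℕ) (hT : 0 < T)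
    (hd : 8 * T ≤ d) :
    ∃ A0 ⊆ A, T * A0.card ≤ A.card ∧
      4 * ∑ b ∈ B.filter (fun b => (A0.filter fun a => inc a b).card ≤ d), (A.filter fun a => inc a b).card
        ≤ 8 * d * T * B.card + ed inc A B := by
  obtain ⟨χ, hχ⟩ := colour (fun a b => if inc a b then (1:ℤ) else 0) (fun a b => by by_cases h : inc a b <;> simp [h]) A B T hT
  haveI : NeZero T := ⟨hT.ne'⟩
  have hcard : ∑ c : Fin T, T * (A.filter fun a => χ a = c).card ≤ ∑ c : Fin T, A.card := by
    rw [← Finset.mul_sum]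
    have := Finset.card_eq_sum_card_fiberwise (s := A) (t := Finset.univ) (f := χ) (by simp)
    rw [← this]
    simp
  obtain ⟨c, -, hc⟩ := Finset.exists_le_of_sum_le Finset.univ_nonempty hcard
  refine ⟨A.filter fun a => χ a = c, Finset.filter_subset _ _, hc, ?_⟩
  set A0 := A.filter fun a => χ a = c
  set n : β → ℕ := fun b => (A.filter fun a => inc a b).card with hn
  set r : β → ℕ := fun b => (A0.filter fun a => inc a b).card with hr
  have hV : ∑ b ∈ B, ((T:ℤ) * r b - n b) ^ 2 ≤ (T:ℤ) ^ 2 * ed inc A B := by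
    have h1 : ∀ b, ((T:ℤ) * r b - n b) = ∑ a ∈ A, (if inc a b then (1:ℤ) else 0) * (T * (if χ a = c then 1 else 0) - 1) := by
      intro b
      simp only [hr, hn, A0, Finset.filter_filter, Finset.card_filter]
      push_cast
      rw [Finset.mul_sum, ← Finset.sum_sub_distrib]
      apply Finset.sum_congr rfl
      intro a _
      by_cases h1 : inc a b <;> by_cases h2 : χ a = c <;> simp [h1, h2]
    simp only [h1]
    refine le_trans ?_ (hχ.trans (le_of_eq ?_))
    · exact Finset.single_le_sum (f := fun c => ∑ b ∈ B, (∑ a ∈ A, (if inc a b then (1:ℤ) else 0) * (T * (if χ a = c then 1 else 0) - 1)) ^ 2)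
        (fun c _ => Finset.sum_nonneg fun b _ => sq_nonneg _) (Finset.mem_univ c)
    · simp [ed]
  have hpt : ∀ b ∈ B.filter (fun b => r b ≤ d), (d : ℤ) * T * n b ≤ 2 * d ^ 2 * T ^ 2 + 2 * ((T:ℤ) * r b - n b) ^ 2 := by
    intro b hb
    have hrd : (r b : ℤ) ≤ d := by exact_mod_cast (Finset.mem_filter.1 hb).2
    have hr0 : (0:ℤ) ≤ r b := by positivity
    have hT0 : (0:ℤ) ≤ T := by positivity
    have hd0 : (0:ℤ) ≤ d := by positivity
    have hTr : (T:ℤ) * r b ≤ T * d := mul_le_mul_of_nonneg_left hrd hT0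
    have hTr0 : (0:ℤ) ≤ T * r b := by positivity
    have hTd0 : (0:ℤ) ≤ d * T := by positivity
    rcases le_total (n b : ℤ) (2 * (d * T)) with h | h
    · nlinarith [mul_le_mul_of_nonneg_left h hTd0, sq_nonneg ((T:ℤ) * r b - n b)]
    · have h2 : (n b : ℤ) ≤ 2 * (n b - T * r b) := by nlinarith
      have h3 : (n b : ℤ) ^ 2 ≤ 4 * ((T:ℤ) * r b - n b) ^ 2 := by
        have : (0:ℤ) ≤ n b := by positivity
        nlinarith
      nlinarith
  have hsum := Finset.sum_le_sum hpt
  rw [← Finset.mul_sum, Finset.sum_add_distrib, ← Finset.mul_sum (f := fun b => ((T:ℤ) * r b - n b) ^ 2)] at hsum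
  have h4 : ∑ b ∈ B.filter (fun b => r b ≤ d), ((T:ℤ) * r b - n b) ^ 2 ≤ ∑ b ∈ B, ((T:ℤ) * r b - n b) ^ 2 :=
    Finset.sum_le_sum_of_subset_of_nonneg (Finset.filter_subset _ _) (fun _ _ _ => sq_nonneg _)
  have h5 : ∑ b ∈ B.filter (fun b => r b ≤ d), (2 * (d:ℤ) ^ 2 * T ^ 2) ≤ B.card * (2 * (d:ℤ) ^ 2 * T ^ 2) := by
    rw [Finset.sum_const, nsmul_eq_mul]
    have : ((B.filter (fun b => r b ≤ d)).card : ℤ) ≤ B.card := by exact_mod_cast Finset.card_filter_le _ _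
    gcongr
  set P : ℕ := ∑ b ∈ B.filter (fun b => r b ≤ d), n b with hP
  have hPc : ∑ b ∈ B.filter (fun b => r b ≤ d), (n b : ℤ) = P := by rw [hP]; push_cast; rfl
  rw [hPc] at hsum
  have h6 : (d:ℤ) * T * P ≤ B.card * (2 * (d:ℤ) ^ 2 * T ^ 2) + 2 * (T ^ 2 * ed inc A B) := by linarith
  have hT1 : (1:ℤ) ≤ T := by exact_mod_cast hT
  have hd8 : 8 * (T:ℤ) ≤ d := by exact_mod_cast hd
  have he0 : (0:ℤ) ≤ ed inc A B := by positivity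
  have h7 : (d:ℤ) * T * (4 * P) ≤ (d:ℤ) * T * (8 * d * T * B.card + ed inc A B) := by
    have : 8 * (T:ℤ) * (T * ed inc A B) ≤ d * (T * ed inc A B) := by gcongr
    nlinarith
  have h8 := le_of_mul_le_mul_left h7 (by nlinarith)
  exact_mod_cast h8
end Rud


namespace Rud
open MvPolynomial

def Inc {α β K : Type*} [Field K] (ξ η ζ : α → K) (ξ' η' ζ' : β → K) (a : α) (b : β) : Prop :=
  ξ a * (η' b - ζ a) = ξ' b * (η a - ζ' b)

open Classical in
lemma factor_count {α β K : Type*} [Field K] (ξ η ζ : α → K) (ξ' η' ζ' : β → K)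
    (hξ : ∀ a, ξ a ≠ 0) (hξ' : ∀ b, ξ' b ≠ 0) (hζ : Function.Injective ζ)
    (f : MvPolynomial (Fin 3) K) (G : Finset α) (B : Finset β) (k : ℕ)
    (hG : ∀ a ∈ G, lineA (ξ a) (η a) (ζ a) f = 0)
    (hgood : ∀ a ∈ G, ∀ b, lineB (ξ' b) (η' b) (ζ' b) f = 0 → Inc ξ η ζ ξ' η' ζ' a b)
    (hk : ∀ a ∈ G, ∀ a' ∈ G, a ≠ a' →
      (B.filter fun b => Inc ξ η ζ ξ' η' ζ' a b ∧ Inc ξ η ζ ξ' η' ζ' a' b).card ≤ k) :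
    ed (Inc ξ η ζ ξ' η' ζ') G B ≤ f.totalDegree * B.card + B.card + k * G.card := by
  rw [ed_eq, ← Finset.sum_filter_add_sum_filter_not B (fun b => lineB (ξ' b) (η' b) (ζ' b) f = 0)]
  have h1 : ∑ b ∈ B.filter (fun b => ¬ lineB (ξ' b) (η' b) (ζ' b) f = 0), (G.filter fun a => Inc ξ η ζ ξ' η' ζ' a b).card
      ≤ f.totalDegree * B.card := by
    calc _ ≤ ∑ b ∈ B.filter (fun b => ¬ lineB (ξ' b) (η' b) (ζ' b) f = 0), f.totalDegree := by
          apply Finset.sum_le_sum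
          intro b hb
          refine card_roots_le _ (Finset.mem_filter.1 hb).2 _ (lineB_natDegree _ _ _ f) _ (fun a => (η' b - ζ a) / ξ' b) ?_ ?_
          · intro a _ a' _ h
            apply hζ
            have := (div_left_inj' (hξ' b)).1 h
            exact sub_right_injective this
          · intro a ha
            obtain ⟨ha, hinc⟩ := Finset.mem_filter.1 ha
            obtain ⟨h2, h3⟩ := meet _ _ _ _ _ _ (hξ a) (hξ' b) hinc f
            rw [← h3, ← h2, hG a ha]; simp
      _ = f.totalDegree * (B.filter (fun b => ¬ lineB (ξ' b) (η' b) (ζ' b) f = 0)).card := by simp [mul_comm]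
      _ ≤ _ := by gcongr; exact Finset.filter_subset _ _
  have h2 : ∑ b ∈ B.filter (fun b => lineB (ξ' b) (η' b) (ζ' b) f = 0), (G.filter fun a => Inc ξ η ζ ξ' η' ζ' a b).card
      ≤ B.card + k * G.card := by
    have h3 : ∑ b ∈ B.filter (fun b => lineB (ξ' b) (η' b) (ζ' b) f = 0), (G.filter fun a => Inc ξ η ζ ξ' η' ζ' a b).card
       ≤ (B.filter (fun b => lineB (ξ' b) (η' b) (ζ' b) f = 0)).card * G.card := by
      calc _ ≤ ∑ b ∈ B.filter (fun b => lineB (ξ' b) (η' b) (ζ' b) f = 0), G.card :=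
            Finset.sum_le_sum fun b _ => Finset.card_filter_le _ _
        _ = _ := by simp
    refine h3.trans ?_
    rcases le_or_gt G.card 1 with hc | hc
    · calc _ ≤ B.card * 1 := Nat.mul_le_mul (Finset.card_filter_le _ _) hc
        _ ≤ _ := by omega
    · obtain ⟨a, ha, a', ha', hne⟩ := Finset.one_lt_card.1 hc
      have h4 : (B.filter (fun b => lineB (ξ' b) (η' b) (ζ' b) f = 0)).card ≤ k := by
        refine le_trans (Finset.card_le_card ?_) (hk a ha a' ha' hne)
        intro b hb
        obtain ⟨hb, hz⟩ := Finset.mem_filter.1 hb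
        exact Finset.mem_filter.2 ⟨hb, hgood a ha b hz, hgood a' ha' b hz⟩
      calc _ ≤ k * G.card := Nat.mul_le_mul_right _ h4
        _ ≤ _ := by omega
  omega

open Classical in
lemma step {α β K : Type*} [Field K] (p : ℕ) [Fact p.Prime] [CharP K p] (ξ η ζ : α → K) (ξ' η' ζ' : β → K)
    (hξ : ∀ a, ξ a ≠ 0) (hξ' : ∀ b, ξ' b ≠ 0) (hζ : Function.Injective ζ) (hζ' : Function.Injective ζ')
    (A : Finset α) (B : Finset β) (k : ℕ)
    (hk : ∀ a ∈ A, ∀ a' ∈ A, a ≠ a' →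
      (B.filter fun b => Inc ξ η ζ ξ' η' ζ' a b ∧ Inc ξ η ζ ξ' η' ζ' a' b).card ≤ k)
    (T D : ℕ) (hT : 0 < T) (hD : 8 * T ≤ 3 * D) (hDp : 3 * D < p) (hn : 3 * A.card ≤ T * D ^ 2) :
    ∃ A' ⊆ A, A'.card ≤ 15 * (3 * D) ^ 2 ∧
      3 * ed (Inc ξ η ζ ξ' η' ζ') A B ≤ 4 * ed (Inc ξ η ζ ξ' η' ζ') A' B
        + 8 * (3 * D) * (T + 1) * B.card + 4 * (3 * D) * A.card + 4 * k * A.card := by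
  set inc := Inc ξ η ζ ξ' η' ζ' with hinc
  obtain ⟨A0, hA0, hA0c, hpoor⟩ := sample inc A B T (3 * D) hT hD
  set d := 3 * D with hd
  obtain ⟨F, hF0, hFd, hFA⟩ := exists_vanish ξ η ζ A0 D (by
    have h1 : T * (3 * A0.card) ≤ T * D ^ 2 := by nlinarith
    have h2 : 3 * A0.card ≤ D ^ 2 := Nat.le_of_mul_le_mul_left h1 hT
    nlinarith)
  obtain ⟨S, hSirr, hSdeg, hSφ⟩ := factor_family F hF0
  have hdegf : ∀ f ∈ S, f.totalDegree ≤ d := fun f hf =>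
    (Finset.single_le_sum (f := fun f => totalDegree f) (fun _ _ => Nat.zero_le _) hf).trans (hSdeg.trans hFd)
  have hbad : ∀ f : MvPolynomial (Fin 3) K, ∃ Bad : Finset α, f ∈ S → (Bad ⊆ A ∧ Bad.card ≤ 15 * f.totalDegree ^ 2 ∧
      ∀ a ∈ A, lineA (ξ a) (η a) (ζ a) f = 0 → a ∉ Bad → ∀ b, lineB (ξ' b) (η' b) (ζ' b) f = 0 → inc a b) := by
    intro f
    by_cases hf : f ∈ S
    · obtain ⟨Bad, h1, h2, h3⟩ := bad_count p f (hSirr f hf) ((hdegf f hf).trans_lt hDp) ξ η ζ A hζ ξ' η' ζ' hξ'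
      exact ⟨Bad, fun _ => ⟨h1, h2, h3⟩⟩
    · exact ⟨∅, fun h => absurd h hf⟩
  choose Bad hBad using hbad
  let R := B.filter fun b => ¬ (A0.filter fun a => inc a b).card ≤ d
  let A' := S.biUnion Bad
  have hA' : A' ⊆ A := Finset.biUnion_subset.2 fun f hf => (hBad f hf).1
  have hSd : ∑ f ∈ S, f.totalDegree ≤ d := hSdeg.trans hFd
  have hSc : S.card ≤ d := by
    refine le_trans ?_ hSd
    rw [Finset.card_eq_sum_ones]
    exact Finset.sum_le_sum fun f hf => irr_deg f (hSirr f hf)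
  have hA'c : A'.card ≤ 15 * d ^ 2 := by
    refine Finset.card_biUnion_le.trans ?_
    calc _ ≤ ∑ f ∈ S, 15 * f.totalDegree ^ 2 := Finset.sum_le_sum fun f hf => (hBad f hf).2.1
      _ = 15 * ∑ f ∈ S, f.totalDegree ^ 2 := by rw [Finset.mul_sum]
      _ ≤ 15 * ∑ f ∈ S, d * f.totalDegree := by
          gcongr with f hf
          rw [pow_two]
          exact Nat.mul_le_mul_right _ (hdegf f hf)
      _ ≤ 15 * d ^ 2 := by
          rw [← Finset.mul_sum]
          nlinarith
  refine ⟨A', hA', hA'c, ?_⟩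
  -- rich b
  have hrich : ∀ b ∈ R, lineB (ξ' b) (η' b) (ζ' b) F = 0 := by
    intro b hb
    by_contra hne
    apply (Finset.mem_filter.1 hb).2
    refine card_roots_le _ hne _ ((lineB_natDegree _ _ _ F).trans hFd) _ (fun a => (η' b - ζ a) / ξ' b) ?_ ?_
    · intro a _ a' _ h
      apply hζ
      have := (div_left_inj' (hξ' b)).1 h
      exact sub_right_injective this
    · intro a ha
      obtain ⟨ha, hi⟩ := Finset.mem_filter.1 ha
      obtain ⟨h2, h3⟩ := meet _ _ _ _ _ _ (hξ a) (hξ' b) hi F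
      rw [← h3, ← h2, hFA a ha]; simp
  have hrichA : ∀ a, ¬ (R.filter fun b => inc a b).card ≤ d → lineA (ξ a) (η a) (ζ a) F = 0 := by
    intro a ha
    by_contra hne
    apply ha
    refine card_roots_le _ hne _ ((lineA_natDegree _ _ _ F).trans hFd) _ (fun b => (η a - ζ' b) / ξ a) ?_ ?_
    · intro b _ b' _ h
      apply hζ'
      have := (div_left_inj' (hξ a)).1 h
      exact sub_right_injective this
    · intro b hb
      obtain ⟨hb, hi⟩ := Finset.mem_filter.1 hb
      obtain ⟨h2, h3⟩ := meet _ _ _ _ _ _ (hξ a) (hξ' b) hi F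
      rw [h2, hrich b hb]; simp
  -- the edge count
  have he : ed inc A B = ∑ b ∈ B.filter (fun b => (A0.filter fun a => inc a b).card ≤ d), (A.filter fun a => inc a b).card
      + ed inc A R := by
    rw [ed_eq, ed_eq, Finset.sum_filter_add_sum_filter_not]
  let G : MvPolynomial (Fin 3) K → Finset α := fun f => A.filter fun a => lineA (ξ a) (η a) (ζ a) f = 0 ∧ a ∉ Bad f
  let Q := A.filter fun a => (R.filter fun b => inc a b).card ≤ d
  -- assignment
  have hasg : ∀ a : α, ∃ f, (a ∈ A \ (Q ∪ A')) → (f ∈ S ∧ a ∈ G f) := by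
    intro a
    by_cases ha : a ∈ A \ (Q ∪ A')
    · obtain ⟨h1, h2⟩ := Finset.mem_sdiff.1 ha
      rw [Finset.mem_union, not_or] at h2
      have h3 : ¬ (R.filter fun b => inc a b).card ≤ d := fun h => h2.1 (Finset.mem_filter.2 ⟨h1, h⟩)
      obtain ⟨f, hf, hf0⟩ := hSφ _ (hrichA a h3)
      refine ⟨f, fun _ => ⟨hf, Finset.mem_filter.2 ⟨h1, hf0, fun h => h2.2 ?_⟩⟩⟩
      exact Finset.mem_biUnion.2 ⟨f, hf, h⟩
    · exact ⟨0, fun h => absurd h ha⟩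
  choose as has using hasg
  let W := A \ (Q ∪ A')
  have hW : ed inc W R ≤ d * B.card + d * B.card + k * A.card := by
    have h1 : ed inc W R = ∑ f ∈ S, ed inc (W.filter fun a => as a = f) R := by
      unfold ed
      rw [Finset.sum_fiberwise_of_maps_to]
      intro a ha
      exact (has a ha).1
    rw [h1]
    have h2 : ∀ f ∈ S, ed inc (W.filter fun a => as a = f) R ≤
        f.totalDegree * R.card + R.card + k * (W.filter fun a => as a = f).card := by
      intro f hf
      have hm : ∀ a ∈ W.filter (fun a => as a = f), a ∈ G f := by
        intro a ha
        obtain ⟨h3, h4⟩ := Finset.mem_filter.1 ha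
        rw [← h4]; exact (has a h3).2
      refine factor_count ξ η ζ ξ' η' ζ' hξ hξ' hζ f _ R k ?_ ?_ ?_
      · intro a ha
        exact (Finset.mem_filter.1 (hm a ha)).2.1
      · intro a ha b hb
        have h5 := Finset.mem_filter.1 (hm a ha)
        exact (hBad f hf).2.2 a h5.1 h5.2.1 h5.2.2 b hb
      · intro a ha a' ha' hne
        refine le_trans (Finset.card_le_card ?_) (hk a (Finset.mem_filter.1 (hm a ha)).1 a' (Finset.mem_filter.1 (hm a' ha')).1 hne)
        exact Finset.filter_subset_filter _ (Finset.filter_subset _ _)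
    refine (Finset.sum_le_sum h2).trans ?_
    rw [Finset.sum_add_distrib, Finset.sum_add_distrib, ← Finset.sum_mul, ← Finset.mul_sum]
    have h3 : ∑ f ∈ S, (W.filter fun a => as a = f).card = W.card := by
      rw [← Finset.card_eq_sum_card_fiberwise]
      intro a ha
      exact (has a ha).1
    have hRB : R.card ≤ B.card := Finset.card_filter_le _ _
    have hWA : W.card ≤ A.card := Finset.card_le_card Finset.sdiff_subset
    rw [h3]
    simp only [Finset.sum_const, smul_eq_mul]
    gcongr
  have hQ : ed inc Q R ≤ d * A.card := by
    rw [ed_eq']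
    calc _ ≤ ∑ a ∈ Q, d := Finset.sum_le_sum fun a ha => (Finset.mem_filter.1 ha).2
      _ = d * Q.card := by simp [mul_comm]
      _ ≤ _ := by gcongr; exact Finset.filter_subset _ _
  have hA'R : ed inc A' R ≤ ed inc A' B := by
    rw [ed_eq, ed_eq]; exact Finset.sum_le_sum_of_subset (Finset.filter_subset _ _)
  have hAR : ed inc A R ≤ ed inc Q R + ed inc A' R + ed inc W R := by
    have h1 : A ⊆ (Q ∪ A') ∪ W := by
      intro a ha
      by_cases h : a ∈ Q ∪ A'
      · exact Finset.mem_union_left _ h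
      · exact Finset.mem_union_right _ (Finset.mem_sdiff.2 ⟨ha, h⟩)
    have h2 := ed_mono_left inc R h1
    have h3 := ed_union_left inc (Q ∪ A') W R
    have h4 := ed_union_left inc Q A' R
    omega
  have e1 : 8 * d * (T + 1) * B.card = 8 * d * T * B.card + 8 * (d * B.card) := by ring
  have e2 : 4 * d * A.card = 4 * (d * A.card) := by ring
  have e3 : 4 * k * A.card = 4 * (k * A.card) := by ring
  rw [e1, e2, e3]
  omega
end Rud


namespace Rud
open MvPolynomial

open Classical in
lemma abs_bound {α β K : Type*} [Field K] (p : ℕ) [Fact p.Prime] [CharP K p] (ξ η ζ : α → K) (ξ' η' ζ' : β → K)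
    (hξ : ∀ a, ξ a ≠ 0) (hξ' : ∀ b, ξ' b ≠ 0) (hζ : Function.Injective ζ) (hζ' : Function.Injective ζ')
    (B : Finset β) (k : ℕ) (N : ℕ) : ∀ (A : Finset α), A.card = N → A.card < p ^ 2 →
    (∀ a ∈ A, ∀ a' ∈ A, a ≠ a' →
      (B.filter fun b => Inc ξ η ζ ξ' η' ζ' a b ∧ Inc ξ η ζ ξ' η' ζ' a' b).card ≤ k) →
    (ed (Inc ξ η ζ ξ' η' ζ') A B : ℝ) ≤ 10 ^ 6 * (√(A.card) * (B.card + A.card) + k * A.card) := by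
  induction N using Nat.strong_induction_on with
  | _ N ih =>
  intro A hN hp hk
  set n := A.card with hn
  have hs := Real.sq_sqrt (Nat.cast_nonneg (α := ℝ) n)
  have hs0 := Real.sqrt_nonneg (n : ℝ)
  have hm0 : (0:ℝ) ≤ B.card := Nat.cast_nonneg _
  have hn0 : (0:ℝ) ≤ n := Nat.cast_nonneg _
  have hk0 : (0:ℝ) ≤ k := Nat.cast_nonneg _
  rcases lt_or_ge n (10 ^ 12) with hsm | hbig
  · have h1 : (ed (Inc ξ η ζ ξ' η' ζ') A B : ℝ) ≤ n * B.card := by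
      exact_mod_cast ed_le (Inc ξ η ζ ξ' η' ζ') A B
    have h2 : √(n:ℝ) ≤ 10 ^ 6 := by
      apply Real.sqrt_le_iff.2
      constructor
      · norm_num
      · have : (n:ℝ) < 10 ^ 12 := by exact_mod_cast hsm
        linarith
    have h3 : √(n:ℝ) * √(n:ℝ) * B.card ≤ 10 ^ 6 * √(n:ℝ) * B.card := by gcongr
    have h4 : (n:ℝ) = √(n:ℝ) * √(n:ℝ) := by rw [← pow_two]; exact hs.symm
    have h5 : 0 ≤ √(n:ℝ) * n := mul_nonneg hs0 hn0
    have h6 : (0:ℝ) ≤ k * n := mul_nonneg hk0 hn0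
    rw [← h4] at h3
    linarith
  · set s := Nat.sqrt (3 * n / 6480) with hsdef
    have hs1 : s * s ≤ 3 * n / 6480 := Nat.sqrt_le _
    have hs2 : 3 * n / 6480 < (s + 1) * (s + 1) := Nat.lt_succ_sqrt _
    have hs3 : 17280 ≤ s := by
      rw [hsdef, Nat.le_sqrt]
      omega
    have hT1 : 3 * n ≤ 6480 * (s + 1) ^ 2 := by
      rw [pow_two]; omega
    have hT2 : 540 * (s + 1) ^ 2 ≤ n := by
      have : (s + 1) ^ 2 ≤ 4 * (s * s) := by nlinarith
      omega
    have hdp : 3 * (s + 1) < p := by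
      by_contra h
      push Not at h
      have : p ^ 2 ≤ (3 * (s + 1)) ^ 2 := Nat.pow_le_pow_left h 2
      have h2 : (3 * (s + 1)) ^ 2 = 9 * (s + 1) ^ 2 := by ring
      omega
    obtain ⟨A', hA', hA'c, hst⟩ := step p ξ η ζ ξ' η' ζ' hξ hξ' hζ hζ' A B k hk 6480 (s + 1) (by norm_num) (by omega) hdp hT1
    have hq : 4 * A'.card ≤ n := by
      have h2 : 15 * (3 * (s + 1)) ^ 2 = 135 * (s + 1) ^ 2 := by ring
      omega
    have hih := ih A'.card (by omega) A' rfl (by omega)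
      (fun a ha a' ha' hne => hk a (hA' ha) a' (hA' ha') hne)
    have hqR : (4:ℝ) * A'.card ≤ n := by exact_mod_cast hq
    have hsq : √(A'.card : ℝ) ≤ √(n:ℝ) / 2 := by
      apply Real.sqrt_le_iff.2
      constructor
      · positivity
      · nlinarith
    have hd : (3 * ((s:ℝ) + 1)) ≤ √(n:ℝ) := by
      apply Real.le_sqrt_of_sq_le
      have : (540:ℝ) * (s + 1) ^ 2 ≤ n := by exact_mod_cast hT2
      nlinarith
    have hstR : (3:ℝ) * ed (Inc ξ η ζ ξ' η' ζ') A B ≤ 4 * ed (Inc ξ η ζ ξ' η' ζ') A' B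
        + 8 * (3 * (s + 1)) * (6480 + 1) * B.card + 4 * (3 * (s + 1)) * n + 4 * k * n := by
      exact_mod_cast hst
    have hc0 : (0:ℝ) ≤ A'.card := Nat.cast_nonneg _
    have i1 : √(A'.card : ℝ) * (B.card + A'.card) ≤ √(n:ℝ) / 2 * (B.card + n) := by
      gcongr
      linarith
    have i2 : (k:ℝ) * A'.card ≤ k * (n / 4) := by
      gcongr; linarith
    have i3 : 3 * ((s:ℝ) + 1) * B.card ≤ √(n:ℝ) * B.card := by gcongr
    have i4 : 3 * ((s:ℝ) + 1) * n ≤ √(n:ℝ) * n := by gcongr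
    have i5 : 0 ≤ √(n:ℝ) * n := by positivity
    have i6 : (0:ℝ) ≤ k * n := by positivity
    have i7 : 0 ≤ √(n:ℝ) * B.card := by positivity
    nlinarith
end Rud


namespace Rud

lemma chunk {α β : Type*} (inc : α → β → Prop) (B : Finset β) (q : ℕ) (hq : 0 < q) (W : ℝ) (hW : 0 ≤ W) (N : ℕ) :
    ∀ A : Finset α, A.card = N → (∀ A' ⊆ A, A'.card ≤ q → (ed inc A' B : ℝ) ≤ W) →
      (ed inc A B : ℝ) ≤ ((N / q + 1 : ℕ) : ℝ) * W := by
  classical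
  induction N using Nat.strong_induction_on with
  | _ N ih =>
  intro A hN h
  rcases le_or_gt A.card q with hc | hc
  · have h1 := h A subset_rfl hc
    have h2 : (1:ℝ) ≤ ((N / q + 1 : ℕ) : ℝ) := by
      push_cast
      have : (0:ℝ) ≤ ((N / q : ℕ) : ℝ) := Nat.cast_nonneg _
      linarith
    nlinarith
  · obtain ⟨A', hA', hc'⟩ := Finset.exists_subset_card_eq hc.le
    have h1 := h A' hA' hc'.le
    have hcd : (A \ A').card = N - q := by rw [Finset.card_sdiff_of_subset hA', hN, hc']
    have h2 := ih (N - q) (by omega) (A \ A') hcd (fun A'' h3 h4 => h A'' (h3.trans Finset.sdiff_subset) h4)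
    have h3 : (N - q) / q + 1 = N / q := (Nat.div_eq_sub_div hq (by omega)).symm
    rw [h3] at h2
    have h4 := ed_union_left inc A' (A \ A') B
    rw [Finset.union_sdiff_of_subset hA'] at h4
    have h5 : (ed inc A B : ℝ) ≤ ed inc A' B + ed inc (A \ A') B := by exact_mod_cast h4
    push_cast
    linarith

/-- triples -/
abbrev Tr (F : Type) [Field F] := {t : F × F × F // t.1 ≠ 0 ∧ t.2.1 ≠ 0}

/-- the incidence relation for triples `(x, y, z)` -/
def TInc {F : Type} [Field F] (a b : Tr F) : Prop :=
  a.1.1 * (b.1.2.1 - a.1.2.2) = b.1.1 * (a.1.2.1 - b.1.2.2)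

open Classical in
lemma tr_common {F : Type} [Field F] (X Y Z : Finset F) (a a' : Tr F) (hne : a ≠ a') (B : Finset (Tr F))
    (hB : ∀ b ∈ B, b.1.1 ∈ X ∧ b.1.2.1 ∈ Y ∧ b.1.2.2 ∈ Z) :
    (B.filter fun b => TInc a b ∧ TInc a' b).card ≤ max X.card Y.card := by
  obtain ⟨⟨x, y, z⟩, hx, hy⟩ := a
  obtain ⟨⟨x', y', z'⟩, hx', hy'⟩ := a'
  dsimp only at hx hy hx' hy'
  have key : ∀ b c : Tr F, TInc ⟨⟨x, y, z⟩, hx, hy⟩ b → TInc ⟨⟨x, y, z⟩, hx, hy⟩ c → b.1.1 = c.1.1 → b.1.2.1 = c.1.2.1 → b = c := by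
    rintro ⟨⟨u, v, w⟩, hu, hv⟩ ⟨⟨u', v', w'⟩, hu', hv'⟩ h1 h2 h3 h4
    simp only [TInc] at h1 h2 h3 h4 hu
    subst h3 h4
    have : w = w' := by
      have := mul_left_cancel₀ hu (h1.symm.trans h2)
      exact sub_right_injective this
    subst this
    rfl
  by_cases hxx : x = x'
  · subst hxx
    by_cases hyy : y = y'
    · subst hyy
      have hz : z ≠ z' := by rintro rfl; exact hne rfl
      rw [Finset.card_eq_zero.2]
      · simp
      · apply Finset.filter_eq_empty_iff.2
        rintro ⟨⟨u, v, w⟩, hu, hv⟩ _ ⟨h1, h2⟩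
        simp only [TInc] at h1 h2
        have := mul_left_cancel₀ hx (h1.trans h2.symm)
        exact hz (sub_right_injective this)
    · refine le_trans (Finset.card_le_card_of_injOn (t := Y) (fun b => b.1.2.1) ?_ ?_) (le_max_right _ _)
      · intro b hb
        exact (hB b (Finset.mem_filter.1 hb).1).2.1
      · intro b hb c hc h
        obtain ⟨-, h1, h2⟩ := Finset.mem_filter.1 hb
        obtain ⟨-, h3, h4⟩ := Finset.mem_filter.1 hc
        refine key b c h1 h3 ?_ h
        simp only [TInc] at h1 h2 h3 h4
        have : y - y' ≠ 0 := sub_ne_zero.2 hyy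
        apply mul_right_cancel₀ this
        linear_combination h2 - h1 + h3 - h4
  · refine le_trans (Finset.card_le_card_of_injOn (t := X) (fun b => b.1.1) ?_ ?_) (le_max_left _ _)
    · intro b hb
      exact (hB b (Finset.mem_filter.1 hb).1).1
    · intro b hb c hc h
      obtain ⟨-, h1, h2⟩ := Finset.mem_filter.1 hb
      obtain ⟨-, h3, h4⟩ := Finset.mem_filter.1 hc
      refine key b c h1 h3 h ?_
      simp only [TInc] at h1 h2 h3 h4 h
      rw [h] at h1 h2
      have : x - x' ≠ 0 := sub_ne_zero.2 hxx
      apply mul_left_cancel₀ this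
      linear_combination h1 - h2 - h3 + h4

lemma lin_indep {F : Type} [Field F] (a b c d : F)
    (h : algebraMap F (RatFunc F) a + algebraMap F (RatFunc F) b * RatFunc.X
      + algebraMap F (RatFunc F) c * RatFunc.X ^ 2 + algebraMap F (RatFunc F) d * RatFunc.X ^ 3 = 0) :
    a = 0 ∧ b = 0 ∧ c = 0 ∧ d = 0 := by
  have h1 : algebraMap (Polynomial F) (RatFunc F) (Polynomial.C a + Polynomial.C b * Polynomial.X
      + Polynomial.C c * Polynomial.X ^ 2 + Polynomial.C d * Polynomial.X ^ 3) = 0 := by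
    rw [← h]
    simp [RatFunc.algebraMap_X, RatFunc.algebraMap_C, RatFunc.algebraMap_eq_C]
  rw [map_eq_zero_iff _ (IsFractionRing.injective (Polynomial F) (RatFunc F))] at h1
  refine ⟨?_, ?_, ?_, ?_⟩
  · simpa [Polynomial.coeff_X, Polynomial.coeff_X_pow, Polynomial.coeff_C] using congrArg (fun q => q.coeff 0) h1
  · simpa [Polynomial.coeff_X, Polynomial.coeff_X_pow, Polynomial.coeff_C] using congrArg (fun q => q.coeff 1) h1
  · simpa [Polynomial.coeff_X, Polynomial.coeff_X_pow, Polynomial.coeff_C] using congrArg (fun q => q.coeff 2) h1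
  · simpa [Polynomial.coeff_X, Polynomial.coeff_X_pow, Polynomial.coeff_C] using congrArg (fun q => q.coeff 3) h1

open Classical in
lemma tr_bound (p : ℕ) [Fact p.Prime] (X Y Z : Finset (ZMod p)) (A B : Finset (Tr (ZMod p)))
    (hB : ∀ b ∈ B, b.1.1 ∈ X ∧ b.1.2.1 ∈ Y ∧ b.1.2.2 ∈ Z) (hA : A.card < p ^ 2) :
    (ed TInc A B : ℝ) ≤ 10 ^ 6 * (√(A.card) * (B.card + A.card) + (max X.card Y.card : ℕ) * A.card) := by
  let K := RatFunc (ZMod p)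
  haveI : CharP K p := charP_of_injective_algebraMap (algebraMap (ZMod p) K).injective p
  let i := algebraMap (ZMod p) K
  let θ : K := RatFunc.X
  let ξ : Tr (ZMod p) → K := fun a => i a.1.1 - θ ^ 2
  let η : Tr (ZMod p) → K := fun a => i a.1.2.1
  let ζ : Tr (ZMod p) → K := fun a => (i a.1.1 * i a.1.2.2 - θ * i a.1.2.1) / ξ a
  let ξ' : Tr (ZMod p) → K := fun a => i a.1.1 + θ
  let ζ' : Tr (ZMod p) → K := fun a => (i a.1.1 * i a.1.2.2 + θ ^ 2 * i a.1.2.1) / ξ' a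
  have hξ : ∀ a, ξ a ≠ 0 := by
    intro a h
    have := lin_indep a.1.1 0 (-1) 0 (by simp only [map_zero, map_neg, map_one]; linear_combination h)
    exact one_ne_zero (neg_eq_zero.1 this.2.2.1)
  have hξ' : ∀ a, ξ' a ≠ 0 := by
    intro a h
    have := lin_indep a.1.1 1 0 0 (by simp only [map_zero, map_one]; linear_combination h)
    exact one_ne_zero this.2.1
  have fin : ∀ a b : Tr (ZMod p), a.1.2.1 = b.1.2.1 → a.1.2.1 * b.1.1 = b.1.2.1 * a.1.1 →
      a.1.1 * a.1.2.2 = b.1.1 * b.1.2.2 → a = b := by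
    rintro ⟨⟨x, y, z⟩, hx, hy⟩ ⟨⟨x', y', z'⟩, hx', hy'⟩ h1 h2 h3
    dsimp only at *
    subst h1
    have := mul_left_cancel₀ hy h2
    subst this
    have := mul_left_cancel₀ hx h3
    subst this
    rfl
  have hζ : Function.Injective ζ := by
    intro a b h
    simp only [ζ] at h
    rw [div_eq_div_iff (hξ a) (hξ b)] at h
    simp only [ξ] at h
    obtain ⟨-, h1, h2, h3⟩ := lin_indep
      (a.1.1 * a.1.2.2 * b.1.1 - b.1.1 * b.1.2.2 * a.1.1) (b.1.2.1 * a.1.1 - a.1.2.1 * b.1.1)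
      (b.1.1 * b.1.2.2 - a.1.1 * a.1.2.2) (a.1.2.1 - b.1.2.1)
      (by simp only [map_sub, map_mul]; linear_combination h)
    exact fin a b (sub_eq_zero.1 h3) (sub_eq_zero.1 h1).symm (sub_eq_zero.1 h2).symm
  have hζ' : Function.Injective ζ' := by
    intro a b h
    simp only [ζ'] at h
    rw [div_eq_div_iff (hξ' a) (hξ' b)] at h
    simp only [ξ'] at h
    obtain ⟨-, h1, h2, h3⟩ := lin_indep
      (a.1.1 * a.1.2.2 * b.1.1 - b.1.1 * b.1.2.2 * a.1.1) (a.1.1 * a.1.2.2 - b.1.1 * b.1.2.2)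
      (a.1.2.1 * b.1.1 - b.1.2.1 * a.1.1) (a.1.2.1 - b.1.2.1)
      (by simp only [map_sub, map_mul]; linear_combination h)
    exact fin a b (sub_eq_zero.1 h3) (sub_eq_zero.1 h2) (sub_eq_zero.1 h1)
  have hinc : Inc ξ η ζ ξ' η ζ' = TInc := by
    funext a b
    apply propext
    have e1 : ξ a * (η b - ζ a) = i a.1.1 * i b.1.2.1 - θ ^ 2 * i b.1.2.1 - (i a.1.1 * i a.1.2.2 - θ * i a.1.2.1) := by
      have : ξ a * ζ a = i a.1.1 * i a.1.2.2 - θ * i a.1.2.1 := mul_div_cancel₀ _ (hξ a)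
      rw [mul_sub, this]; simp only [ξ, η]; ring
    have e2 : ξ' b * (η a - ζ' b) = i b.1.1 * i a.1.2.1 + θ * i a.1.2.1 - (i b.1.1 * i b.1.2.2 + θ ^ 2 * i b.1.2.1) := by
      have : ξ' b * ζ' b = i b.1.1 * i b.1.2.2 + θ ^ 2 * i b.1.2.1 := mul_div_cancel₀ _ (hξ' b)
      rw [mul_sub, this]; simp only [ξ', η]; ring
    unfold Inc TInc
    rw [e1, e2]
    constructor
    · intro h
      apply i.injective
      simp only [map_mul, map_sub]
      linear_combination h
    · intro h
      have := congrArg i h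
      simp only [map_mul, map_sub] at this
      linear_combination this
  have := abs_bound p ξ η ζ ξ' η ζ' hξ hξ' hζ hζ' B (max X.card Y.card) A.card A rfl hA (by
    intro a _ a' _ hne
    rw [hinc]
    exact tr_common X Y Z a a' hne B hB)
  rw [hinc] at this
  exact this

open Classical in
lemma tr_bound2 (p : ℕ) [Fact p.Prime] (X Y Z : Finset (ZMod p)) (B : Finset (Tr (ZMod p)))
    (hB : ∀ b ∈ B, b.1.1 ∈ X ∧ b.1.2.1 ∈ Y ∧ b.1.2.2 ∈ Z) :
    (ed TInc B B : ℝ) ≤ 10 ^ 7 * ((B.card : ℝ) ^ 2 / p + B.card * √(B.card) + (max X.card Y.card : ℕ) * B.card) := by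
  have hp2 : 2 ≤ p := (Fact.out : p.Prime).two_le
  have hp2R : (2:ℝ) ≤ p := by exact_mod_cast hp2
  set n := B.card with hn
  set k := max X.card Y.card
  have hn0 : (0:ℝ) ≤ n := Nat.cast_nonneg _
  have hk0 : (0:ℝ) ≤ k := Nat.cast_nonneg _
  have hs0 := Real.sqrt_nonneg (n:ℝ)
  have t1 : (0:ℝ) ≤ (n:ℝ) ^ 2 / p := by positivity
  have t2 : (0:ℝ) ≤ n * √(n:ℝ) := by positivity
  have t3 : (0:ℝ) ≤ k * n := by positivity
  rcases lt_or_ge n (p ^ 2) with h | h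
  · have := tr_bound p X Y Z B B hB h
    have e : √(n:ℝ) * (n + n) = 2 * (n * √(n:ℝ)) := by ring
    rw [← hn, e] at this
    linarith
  · obtain ⟨q, hq⟩ : ∃ q, p ^ 2 = q + 1 := ⟨p ^ 2 - 1, by have : 0 < p ^ 2 := by positivity
                                                          omega⟩
    have hq3 : 3 ≤ q := by nlinarith
    have hqR : (p:ℝ) ^ 2 = q + 1 := by exact_mod_cast hq
    have hq3R : (3:ℝ) ≤ q := by exact_mod_cast hq3
    have hqn : (q:ℝ) + 1 ≤ n := by rw [hq] at h; exact_mod_cast h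
    have hsub : ∀ A' ⊆ B, A'.card ≤ q → (ed TInc A' B : ℝ) ≤ 10 ^ 6 * (p * (n + n) + k * q) := by
      intro A' hA' hc
      refine (tr_bound p X Y Z A' B hB (by omega)).trans ?_
      have hcR : (A'.card : ℝ) ≤ q := by exact_mod_cast hc
      have hs : √(A'.card : ℝ) ≤ p := by
        apply Real.sqrt_le_iff.2
        exact ⟨by positivity, by linarith⟩
      gcongr
      linarith
    have hch := chunk TInc B q (by omega) (10 ^ 6 * (p * (n + n) + k * q)) (by positivity) n B rfl hsub
    have hnum : ((n / q + 1 : ℕ) : ℝ) ≤ 2 * (n / q) := by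
      push_cast
      have h1 : ((n / q : ℕ) : ℝ) ≤ n / q := Nat.cast_div_le
      have h2 : (1:ℝ) ≤ n / q := by rw [le_div_iff₀ (by linarith)]; linarith
      linarith
    have h3 : ((n / q + 1 : ℕ) : ℝ) * (10 ^ 6 * (p * (n + n) + k * q)) ≤ 2 * (n / q) * (10 ^ 6 * (p * (n + n) + k * q)) := by
      gcongr
    have h4 : 2 * ((n:ℝ) / q) * (10 ^ 6 * (p * (n + n) + k * q)) = 10 ^ 6 * (4 * (n ^ 2 * (p / q)) + 2 * (k * n)) := by
      have : (q:ℝ) ≠ 0 := by linarith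
      field_simp
      ring
    have h5 : (p:ℝ) / q ≤ 2 / p := by
      rw [div_le_div_iff₀ (by linarith) (by linarith)]
      nlinarith
    have h6 : (n:ℝ) ^ 2 * (p / q) ≤ n ^ 2 * (2 / p) := by gcongr
    have h7 : (n:ℝ) ^ 2 * (2 / p) = 2 * (n ^ 2 / p) := by ring
    linarith
end Rud

open Finset

theorem N_count_bound :
    ∃ c : ℝ, 0 < c ∧ ∀ (p : ℕ) (_ : Fact p.Prime) (X Y Z : Finset (ZMod p)),
      (0 : ZMod p) ∉ X → (0 : ZMod p) ∉ Y → (0 : ZMod p) ∉ Z →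
      (Fintype.card {t : (ZMod p × ZMod p) × (ZMod p × ZMod p) × (ZMod p × ZMod p) //
          t.1.1 ∈ X ∧ t.1.2 ∈ X ∧ t.2.1.1 ∈ Y ∧ t.2.1.2 ∈ Y ∧ t.2.2.1 ∈ Z ∧ t.2.2.2 ∈ Z ∧
          t.1.1 * (t.2.1.1 - t.2.2.1) = t.1.2 * (t.2.1.2 - t.2.2.2)} : ℝ)
        ≤ c * ((X.card : ℝ) ^ 2 * (Y.card : ℝ) ^ 2 * (Z.card : ℝ) ^ 2 / p
            + ((X.card : ℝ) * Y.card * Z.card) ^ ((3 : ℝ) / 2)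
            + (max (X.card : ℝ) (max (Y.card : ℝ) (Z.card : ℝ)))
              * X.card * Y.card * Z.card) := by
  classical
  refine ⟨10 ^ 7, by norm_num, ?_⟩
  intro p hp X Y Z hX hY hZ
  let B : Finset (Rud.Tr (ZMod p)) := (X ×ˢ Y ×ˢ Z).subtype _
  have hBmem : ∀ b : Rud.Tr (ZMod p), b ∈ B ↔ b.1.1 ∈ X ∧ b.1.2.1 ∈ Y ∧ b.1.2.2 ∈ Z := by
    intro b
    simp only [B, Finset.mem_subtype, Finset.mem_product]
  have hcard : B.card = X.card * Y.card * Z.card := by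
    simp only [B]
    rw [Finset.card_subtype, Finset.filter_true_of_mem, Finset.card_product, Finset.card_product, mul_assoc]
    intro t ht
    simp only [Finset.mem_product] at ht
    exact ⟨fun h => hX (h ▸ ht.1), fun h => hY (h ▸ ht.2.1)⟩
  have hN : Fintype.card {t : (ZMod p × ZMod p) × (ZMod p × ZMod p) × (ZMod p × ZMod p) //
          t.1.1 ∈ X ∧ t.1.2 ∈ X ∧ t.2.1.1 ∈ Y ∧ t.2.1.2 ∈ Y ∧ t.2.2.1 ∈ Z ∧ t.2.2.2 ∈ Z ∧
          t.1.1 * (t.2.1.1 - t.2.2.1) = t.1.2 * (t.2.1.2 - t.2.2.2)} ≤ Rud.ed Rud.TInc B B := by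
    have h1 : Rud.ed Rud.TInc B B = ((B ×ˢ B).filter fun t => Rud.TInc t.1 t.2).card := by
      rw [Rud.ed, Finset.card_filter, Finset.sum_product]
    have hne : ∀ x ∈ X, ∀ y ∈ Y, x ≠ 0 ∧ y ≠ 0 := fun x hx y hy =>
      ⟨fun h => hX (h ▸ hx), fun h => hY (h ▸ hy)⟩
    rw [h1, ← Fintype.card_coe]
    refine Fintype.card_le_of_injective (fun t =>
      ⟨(⟨(t.1.1.1, t.1.2.1.2, t.1.2.2.1), hne _ t.2.1 _ t.2.2.2.2.1⟩,
        ⟨(t.1.1.2, t.1.2.1.1, t.1.2.2.2), hne _ t.2.2.1 _ t.2.2.2.1⟩), ?_⟩) ?_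
    · obtain ⟨t, h1, h2, h3, h4, h5, h6, h7⟩ := t
      rw [Finset.mem_filter, Finset.mem_product, hBmem, hBmem]
      exact ⟨⟨⟨h1, h4, h5⟩, ⟨h2, h3, h6⟩⟩, h7⟩
    · rintro ⟨⟨⟨a, b⟩, ⟨c, d⟩, ⟨e, f⟩⟩, h⟩ ⟨⟨⟨a', b'⟩, ⟨c', d'⟩, ⟨e', f'⟩⟩, h'⟩ he
      simp only [Subtype.mk.injEq, Prod.mk.injEq] at he ⊢
      tauto
  have hb := Rud.tr_bound2 p X Y Z B (fun b hb => (hBmem b).1 hb)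
  have hNR : (Fintype.card {t : (ZMod p × ZMod p) × (ZMod p × ZMod p) × (ZMod p × ZMod p) //
          t.1.1 ∈ X ∧ t.1.2 ∈ X ∧ t.2.1.1 ∈ Y ∧ t.2.1.2 ∈ Y ∧ t.2.2.1 ∈ Z ∧ t.2.2.2 ∈ Z ∧
          t.1.1 * (t.2.1.1 - t.2.2.1) = t.1.2 * (t.2.1.2 - t.2.2.2)} : ℝ) ≤ Rud.ed Rud.TInc B B := by
    exact_mod_cast hN
  refine hNR.trans (hb.trans ?_)
  have hcR : (B.card : ℝ) = X.card * Y.card * Z.card := by rw [hcard]; push_cast; ring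
  rw [hcR]
  have hr : ((X.card : ℝ) * Y.card * Z.card) ^ ((3 : ℝ) / 2) =
      (X.card : ℝ) * Y.card * Z.card * √((X.card : ℝ) * Y.card * Z.card) := by
    rw [Real.sqrt_eq_rpow, ← Real.rpow_one_add' (by positivity) (by norm_num)]
    norm_num
  rw [hr]
  have e1 : ((X.card : ℝ) * Y.card * Z.card) ^ 2 / p = (X.card : ℝ) ^ 2 * (Y.card : ℝ) ^ 2 * (Z.card : ℝ) ^ 2 / p := by ring
  rw [e1]
  have hm : ((max X.card Y.card : ℕ) : ℝ) ≤ max (X.card : ℝ) (max (Y.card : ℝ) (Z.card : ℝ)) := by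
    push_cast
    exact max_le_max le_rfl (le_max_left _ _)
  have e2 : ((max X.card Y.card : ℕ) : ℝ) * ((X.card : ℝ) * Y.card * Z.card) ≤
      max (X.card : ℝ) (max (Y.card : ℝ) (Z.card : ℝ)) * X.card * Y.card * Z.card := by
    calc _ ≤ max (X.card : ℝ) (max (Y.card : ℝ) (Z.card : ℝ)) * ((X.card : ℝ) * Y.card * Z.card) := by gcongr
      _ = _ := by ring
  gcongr
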